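/- arXiv:2006.14534 — 7 statements merged into one kernel-verified Lean document; each statement's English description precedes it below -/
import Mathlib

section
/- Let n ≥ 2, let u, w ≥ 0 be integers and v ∈ ℤ with v ≠ 0. For every x ∈ L_v with x ∉ B_v^{u,w}, there exists z ∈ L_0 such that x + z ∈ B_v^{u,w} and |η_{u,v,w}(x + z)| ≤ |η_{u,v,w}(x)|. Consequently (assuming additionally that u·w = 0 whenever n divides v), if x ∈ B_v^{u,w} satisfies |η_{u,v,w}(x)| ≤ |η_{u,v,w}(y)| for all y ∈ B_v^{u,w}, then η_{u,v,w}(x) is a geodesic word for the element t^{-u} a^{v} t^{w} of BS(1,n). -/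
abbrev Letter : Type := Fin 2 × Bool

def bsRels (n : ℕ) : Set (FreeGroup (Fin 2)) :=
  {FreeGroup.of 1 * FreeGroup.of 0 * (FreeGroup.of 1)⁻¹ * (FreeGroup.of 0 ^ n)⁻¹}

abbrev BS (n : ℕ) : Type := PresentedGroup (bsRels n)

def bsA (n : ℕ) : BS n := PresentedGroup.of 0

def bsT (n : ℕ) : BS n := PresentedGroup.of 1

def evalLetter (n : ℕ) (l : Letter) : BS n :=
  cond l.2 (if l.1 = 0 then bsA n else bsT n) (if l.1 = 0 then (bsA n)⁻¹ else (bsT n)⁻¹)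

def evalWord (n : ℕ) (wd : List Letter) : BS n := (wd.map (evalLetter n)).prod

noncomputable def wordLength (n : ℕ) (g : BS n) : ℕ :=
  sInf {N : ℕ | ∃ wd : List Letter, evalWord n wd = g ∧ wd.length = N}

def bsSphere (n N : ℕ) : Set (BS n) := {g : BS n | wordLength n g = N}

def sigmaD (n : ℕ) (x : ℕ →₀ ℤ) : ℤ := x.sum fun i c => c * (n : ℤ) ^ i

def l1D (x : ℕ →₀ ℤ) : ℕ := x.sum fun _ c => c.natAbs

def kIdx (x : ℕ →₀ ℤ) : ℕ := x.support.sup id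

noncomputable def wVec (n i : ℕ) : ℕ →₀ ℤ := Finsupp.single i (-(n : ℤ)) + Finsupp.single (i + 1) 1

def etaLen (u w : ℕ) (x : ℕ →₀ ℤ) : ℕ :=
  if kIdx x ≤ w ∨ u ≤ w then
    u + l1D x + kIdx x + ((w : ℤ) - kIdx x).natAbs
  else
    ((kIdx x : ℤ) - u).natAbs + l1D x + kIdx x + w

def BoxSet (n u w : ℕ) (v : ℤ) : Set (ℕ →₀ ℤ) :=
  {x | sigmaD n x = v ∧
    (∀ i < kIdx x, |x i| ≤ ((n / 2 : ℕ) : ℤ)) ∧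
    (kIdx x < max u w → |x (kIdx x)| ≤ ((n / 2 : ℕ) : ℤ)) ∧
    (max u w ≤ kIdx x → |x (kIdx x)| ≤ ((n / 2 : ℕ) : ℤ) + if n = 2 then 2 else 1)}

def absLexLE (x y : ℕ →₀ ℤ) : Prop :=
  (∀ i, |x i| = |y i|) ∨ ∃ i : ℕ, (∀ j < i, |x j| = |y j|) ∧ |x i| < |y i|

def IsMinimalVec (n u w : ℕ) (x : ℕ →₀ ℤ) : Prop :=
  (∀ y : ℕ →₀ ℤ, sigmaD n y = sigmaD n x → etaLen u w x ≤ etaLen u w y) ∧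
  (Even n → ∀ y : ℕ →₀ ℤ, sigmaD n y = sigmaD n x → etaLen u w y = etaLen u w x → absLexLE x y)

namespace RB

lemma eq_zero_of_kIdx_lt {x : ℕ →₀ ℤ} {j : ℕ} (h : kIdx x < j) : x j = 0 := by
  by_contra hx
  have : j ≤ kIdx x := Finset.le_sup (f := id) (Finsupp.mem_support_iff.2 hx)
  omega

lemma kIdx_le {x : ℕ →₀ ℤ} {B : ℕ} (h : ∀ j, B < j → x j = 0) : kIdx x ≤ B := by
  refine Finset.sup_le fun j hj => ?_
  by_contra hc
  exact (Finsupp.mem_support_iff.1 hj) (h j (by simpa using hc))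

lemma supp_sub {x : ℕ →₀ ℤ} {N : ℕ} (h : kIdx x < N) : x.support ⊆ Finset.range N := by
  intro j hj
  have : j ≤ kIdx x := Finset.le_sup (f := id) hj
  simp; omega

lemma sigmaD_range (n : ℕ) {x : ℕ →₀ ℤ} {N : ℕ} (h : kIdx x < N) :
    sigmaD n x = ∑ i ∈ Finset.range N, x i * (n : ℤ) ^ i :=
  Finsupp.sum_of_support_subset _ (supp_sub h) _ (by simp)

lemma l1D_range {x : ℕ →₀ ℤ} {N : ℕ} (h : kIdx x < N) :
    l1D x = ∑ i ∈ Finset.range N, (x i).natAbs :=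
  Finsupp.sum_of_support_subset _ (supp_sub h) _ (by simp)

lemma sigmaD_add (n : ℕ) (x y : ℕ →₀ ℤ) : sigmaD n (x + y) = sigmaD n x + sigmaD n y := by
  unfold sigmaD
  exact Finsupp.sum_add_index' (by simp) (by intros; ring)

lemma sigmaD_single (n i : ℕ) (c : ℤ) : sigmaD n (Finsupp.single i c) = c * (n : ℤ) ^ i := by
  unfold sigmaD
  exact Finsupp.sum_single_index (by simp)

lemma etaLen_eq (u w : ℕ) (x : ℕ →₀ ℤ) :
    etaLen u w x = l1D x + u + w + 2 * (kIdx x - max u w) := by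
  unfold etaLen
  split_ifs <;> omega

lemma sum_two {N i : ℕ} (hi : i + 1 < N) (g g' : ℕ → ℕ) (h : ∀ j, j ≠ i → j ≠ i + 1 → g j = g' j) :
    ∑ j ∈ Finset.range N, g j + g' i + g' (i + 1) = ∑ j ∈ Finset.range N, g' j + g i + g (i + 1) := by
  have key : ∀ f : ℕ → ℕ, ∑ j ∈ Finset.range N, f j =
      f i + (f (i + 1) + ∑ j ∈ ((Finset.range N).erase i).erase (i + 1), f j) := by
    intro f
    rw [Finset.add_sum_erase, Finset.add_sum_erase]
    · simp; omega
    · simp; omega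
  rw [key g, key g']
  have : ∑ j ∈ ((Finset.range N).erase i).erase (i + 1), g j =
      ∑ j ∈ ((Finset.range N).erase i).erase (i + 1), g' j := by
    refine Finset.sum_congr rfl fun j hj => ?_
    simp at hj
    exact h j hj.2.1 hj.1
  rw [this]; ring

def Phi (N : ℕ) (y : ℕ →₀ ℤ) : ℕ := ∑ j ∈ Finset.range N, (y j).natAbs * (N - j)

lemma move (n u w N : ℕ) (y : ℕ →₀ ℤ) (i : ℕ) (hi : i ≤ kIdx y) (hN : kIdx y + 1 < N) (d : ℤ)
    (h1 : (y i - d * n).natAbs + (y (i + 1) + d).natAbs + 2 * (max (kIdx y) (i + 1) - max u w)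
      ≤ (y i).natAbs + (y (i + 1)).natAbs + 2 * (kIdx y - max u w))
    (h2 : (y i - d * n).natAbs < (y i).natAbs) :
    ∃ y' : ℕ →₀ ℤ, sigmaD n y' = sigmaD n y ∧ etaLen u w y' ≤ etaLen u w y ∧ Phi N y' < Phi N y := by
  set y' : ℕ →₀ ℤ := y + (Finsupp.single i (-(d * n)) + Finsupp.single (i + 1) d) with hy'
  have e1 : y' i = y i - d * n := by simp [hy']; ring
  have e2 : y' (i + 1) = y (i + 1) + d := by simp [hy']
  have e3 : ∀ j, j ≠ i → j ≠ i + 1 → y j = y' j := by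
    intro j h h'
    simp [hy', Finsupp.single_apply, h.symm, h'.symm]
  have hk : kIdx y' ≤ max (kIdx y) (i + 1) := by
    refine kIdx_le fun j hj => ?_
    rw [← e3 j (by omega) (by omega)]
    exact eq_zero_of_kIdx_lt (by omega)
  refine ⟨y', ?_, ?_, ?_⟩
  · rw [hy', sigmaD_add, sigmaD_add, sigmaD_single, sigmaD_single]; ring
  · rw [etaLen_eq, etaLen_eq, l1D_range (x := y') (N := N) (by omega),
      l1D_range (x := y) (N := N) (by omega)]
    have := sum_two (N := N) (i := i) (by omega) (fun j => (y j).natAbs) (fun j => (y' j).natAbs)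
      (fun j h h' => by simp only [e3 j h h'])
    simp only [e1, e2] at this
    omega
  · have := sum_two (N := N) (i := i) (by omega) (fun j => (y j).natAbs * (N - j))
      (fun j => (y' j).natAbs * (N - j)) (fun j h h' => by simp only [e3 j h h'])
    simp only [e1, e2] at this
    unfold Phi
    have h3 : (y i - d * n).natAbs + (y (i + 1) + d).natAbs ≤ (y i).natAbs + (y (i + 1)).natAbs := by
      omega
    obtain ⟨C, hC⟩ : ∃ C, N - i = C + 1 := ⟨N - i - 1, by omega⟩
    have hC' : N - (i + 1) = C := by omega
    rw [hC, hC'] at this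
    have := Nat.mul_le_mul_right C h3
    nlinarith

lemma step (n : ℕ) (hn : 2 ≤ n) (u w N : ℕ) (v : ℤ) (y : ℕ →₀ ℤ) (hy : sigmaD n y = v)
    (hb : y ∉ BoxSet n u w v) (hN : kIdx y + 1 < N) :
    ∃ y' : ℕ →₀ ℤ, sigmaD n y' = sigmaD n y ∧ etaLen u w y' ≤ etaLen u w y ∧ Phi N y' < Phi N y := by
  have low : ∀ i, i ≤ kIdx y → (i < kIdx y ∨ kIdx y < max u w) → ((n / 2 : ℕ) : ℤ) < |y i| →
      ∃ y' : ℕ →₀ ℤ, sigmaD n y' = sigmaD n y ∧ etaLen u w y' ≤ etaLen u w y ∧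
        Phi N y' < Phi N y := by
    intro i hi hor hlt
    rcases le_total 0 (y i) with h0 | h0
    · rw [abs_of_nonneg h0] at hlt
      exact move n u w N y i hi hN 1 (by omega) (by omega)
    · rw [abs_of_nonpos h0] at hlt
      exact move n u w N y i hi hN (-1) (by omega) (by omega)
  by_contra hcon
  refine hb ⟨hy, fun i hi => ?_, fun hk => ?_, fun hk => ?_⟩
  · by_contra h
    exact hcon (low i hi.le (Or.inl hi) (not_le.1 h))
  · by_contra h
    exact hcon (low _ le_rfl (Or.inr hk) (not_le.1 h))
  · by_contra h
    apply hcon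
    have h := not_le.1 h
    have hz : y (kIdx y + 1) = 0 := eq_zero_of_kIdx_lt (Nat.lt_succ_self _)
    split_ifs at h with h2
    · rcases le_total 0 (y (kIdx y)) with h0 | h0
      · rw [abs_of_nonneg h0] at h
        exact move n u w N y _ le_rfl hN 2 (by rw [hz]; omega) (by omega)
      · rw [abs_of_nonpos h0] at h
        exact move n u w N y _ le_rfl hN (-2) (by rw [hz]; omega) (by omega)
    · rcases le_total 0 (y (kIdx y)) with h0 | h0
      · rw [abs_of_nonneg h0] at h
        exact move n u w N y _ le_rfl hN 1 (by rw [hz]; omega) (by omega)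
      · rw [abs_of_nonpos h0] at h
        exact move n u w N y _ le_rfl hN (-1) (by rw [hz]; omega) (by omega)

lemma part1 (n : ℕ) (hn : 2 ≤ n) (u w : ℕ) (v : ℤ) (x : ℕ →₀ ℤ) (hx : sigmaD n x = v) :
    ∃ y ∈ BoxSet n u w v, etaLen u w y ≤ etaLen u w x := by
  have main : ∀ p : ℕ, ∀ y : ℕ →₀ ℤ, sigmaD n y = v → etaLen u w y ≤ etaLen u w x →
      Phi (etaLen u w x + max u w + 3) y = p → ∃ y ∈ BoxSet n u w v, etaLen u w y ≤ etaLen u w x := by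
    intro p
    induction p using Nat.strong_induction_on with
    | _ p ih =>
      intro y hy hle hp
      by_cases hb : y ∈ BoxSet n u w v
      · exact ⟨y, hb, hle⟩
      · have hk : kIdx y + 1 < etaLen u w x + max u w + 3 := by
          have := etaLen_eq u w y
          omega
        obtain ⟨y', a, b, c⟩ := step n hn u w _ v y hy hb hk
        exact ih _ (hp ▸ c) y' (a.trans hy) (b.trans hle) rfl
  exact main _ x hx le_rfl rfl

/-! Upper bound -/

def R (n : ℕ) (g : BS n) (N : ℕ) : Prop := ∃ wd : List Letter, evalWord n wd = g ∧ wd.length = N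

lemma R_one (n : ℕ) : R n 1 0 := ⟨[], rfl, rfl⟩

lemma R_mul {n : ℕ} {g h : BS n} {N M : ℕ} (hg : R n g N) (hh : R n h M) : R n (g * h) (N + M) := by
  obtain ⟨a, rfl, rfl⟩ := hg
  obtain ⟨b, rfl, rfl⟩ := hh
  exact ⟨a ++ b, by simp [evalWord], by simp⟩

lemma R_pow {n : ℕ} {g : BS n} (hg : R n g 1) (k : ℕ) : R n (g ^ k) k := by
  induction k with
  | zero => simpa using R_one n
  | succ k ih => rw [pow_succ]; exact R_mul ih hg

lemma R_zpow {n : ℕ} {g : BS n} (hg : R n g 1) (hg' : R n g⁻¹ 1) (z : ℤ) : R n (g ^ z) z.natAbs := by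
  rcases Int.eq_nat_or_neg z with ⟨k, rfl | rfl⟩
  · simpa using R_pow hg k
  · simpa using R_pow hg' k

lemma R_a (n : ℕ) (z : ℤ) : R n (bsA n ^ z) z.natAbs :=
  R_zpow ⟨[(0, true)], by simp [evalWord, evalLetter], rfl⟩
    ⟨[(0, false)], by simp [evalWord, evalLetter], rfl⟩ z

lemma R_t (n : ℕ) (z : ℤ) : R n (bsT n ^ z) z.natAbs :=
  R_zpow ⟨[(1, true)], by simp [evalWord, evalLetter], rfl⟩
    ⟨[(1, false)], by simp [evalWord, evalLetter], rfl⟩ z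

lemma rel (n : ℕ) : bsT n * bsA n * (bsT n)⁻¹ = bsA n ^ n := by
  have h : PresentedGroup.mk (bsRels n)
      (FreeGroup.of 1 * FreeGroup.of 0 * (FreeGroup.of 1)⁻¹ * (FreeGroup.of 0 ^ n)⁻¹) = 1 :=
    PresentedGroup.one_of_mem (by simp [bsRels])
  simp only [map_mul, map_inv, map_pow] at h
  exact mul_inv_eq_one.1 h

lemma rel' (n : ℕ) (z : ℤ) : bsT n * bsA n ^ z = bsA n ^ (z * n) * bsT n := by
  have h : bsT n * bsA n ^ z * (bsT n)⁻¹ = bsA n ^ (z * n) := by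
    rw [← conj_zpow, rel, mul_comm, zpow_mul, zpow_natCast]
  rw [← h]; group

lemma rel_pow (n k : ℕ) (z : ℤ) : bsT n ^ k * bsA n ^ z = bsA n ^ (z * n ^ k) * bsT n ^ k := by
  induction k generalizing z with
  | zero => simp
  | succ k ih =>
    rw [pow_succ, mul_assoc, rel', ← mul_assoc, ih, mul_assoc, ← pow_succ]
    congr 2; ring

lemma R_up (n : ℕ) (f : ℕ → ℤ) (k : ℕ) :
    R n (bsA n ^ (∑ i ∈ Finset.range (k + 1), f i * (n : ℤ) ^ i) * bsT n ^ k)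
      (∑ i ∈ Finset.range (k + 1), (f i).natAbs + k) := by
  induction k with
  | zero => simpa using R_a n (f 0)
  | succ k ih =>
    have ht : R n (bsT n) 1 := by simpa using R_t n 1
    have := R_mul (R_mul ih ht) (R_a n (f (k + 1)))
    rw [mul_assoc (bsA n ^ _), ← pow_succ, mul_assoc, rel_pow, ← mul_assoc, ← zpow_add] at this
    rw [Finset.sum_range_succ, Finset.sum_range_succ _ (k + 1)]
    convert this using 1
    ring

lemma R_down (n : ℕ) (f : ℕ → ℤ) (k : ℕ) :
    R n ((bsT n ^ k)⁻¹ * bsA n ^ (∑ i ∈ Finset.range (k + 1), f i * (n : ℤ) ^ i))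
      (∑ i ∈ Finset.range (k + 1), (f i).natAbs + k) := by
  induction k with
  | zero => simpa using R_a n (f 0)
  | succ k ih =>
    have ht : R n (bsT n)⁻¹ 1 := by simpa using R_t n (-1)
    have := R_mul (R_mul (R_a n (f (k + 1))) ht) ih
    rw [Finset.sum_range_succ, Finset.sum_range_succ _ (k + 1)]
    convert this using 1
    · rw [inv_mul_eq_iff_eq_mul]
      have h := rel_pow n (k + 1) (f (k + 1))
      rw [← mul_assoc, ← mul_assoc, ← mul_assoc, h, add_comm, zpow_add, pow_succ']
      group
    · ring

lemma upper (n u w : ℕ) (x : ℕ →₀ ℤ) :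
    R n (bsT n ^ (-(u : ℤ)) * bsA n ^ (sigmaD n x) * bsT n ^ (w : ℤ)) (etaLen u w x) := by
  have hs := sigmaD_range n (x := x) (Nat.lt_succ_self _)
  have hl := l1D_range (x := x) (Nat.lt_succ_self _)
  unfold etaLen
  split_ifs with h
  · have := R_mul (R_mul (R_t n (-(u : ℤ))) (R_up n x (kIdx x))) (R_t n ((w : ℤ) - kIdx x))
    rw [← Nat.succ_eq_add_one, ← hs, ← hl] at this
    convert this using 1
    · rw [← zpow_natCast]; group
    · simp; ring
  · have := R_mul (R_mul (R_t n ((kIdx x : ℤ) - u)) (R_down n x (kIdx x))) (R_t n (w : ℤ))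
    rw [← Nat.succ_eq_add_one, ← hs, ← hl] at this
    convert this using 1
    · rw [← zpow_natCast]; group
    · simp; ring

/-! Lower bound -/

noncomputable def gens (n : ℕ) (hn : (n : ℚ) ≠ 0) (i : Fin 2) : Equiv.Perm ℚ :=
  if i = 0 then Equiv.addLeft 1 else Equiv.mulLeft₀ (n : ℚ) hn

lemma addLeft_pow (k : ℕ) (x : ℚ) : ((Equiv.addLeft (1 : ℚ)) ^ k : Equiv.Perm ℚ) x = k + x := by
  induction k generalizing x with
  | zero => simp
  | succ k ih => rw [pow_succ, Equiv.Perm.mul_apply, ih]; simp; ring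

noncomputable def phi (n : ℕ) (hn : (n : ℚ) ≠ 0) : BS n →* Equiv.Perm ℚ :=
  PresentedGroup.toGroup (f := gens n hn) (by
    intro r hr
    simp only [bsRels, Set.mem_singleton_iff] at hr
    subst hr
    simp only [map_mul, map_inv, map_pow, FreeGroup.lift_apply_of]
    rw [mul_inv_eq_one]
    ext x
    simp only [gens, if_true, Equiv.Perm.mul_apply, addLeft_pow]
    simp [Equiv.Perm.inv_def]
    field_simp)

lemma phi_a (n : ℕ) (hn : (n : ℚ) ≠ 0) (x : ℚ) : phi n hn (bsA n) x = 1 + x := by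
  simp [phi, bsA, gens]

lemma phi_t (n : ℕ) (hn : (n : ℚ) ≠ 0) (x : ℚ) : phi n hn (bsT n) x = n * x := by
  simp [phi, bsT, gens]

lemma phi_ai (n : ℕ) (hn : (n : ℚ) ≠ 0) (x : ℚ) : phi n hn (bsA n)⁻¹ x = -1 + x := by
  rw [map_inv, Equiv.Perm.inv_eq_iff_eq, phi_a]; ring

lemma phi_ti (n : ℕ) (hn : (n : ℚ) ≠ 0) (x : ℚ) : phi n hn (bsT n)⁻¹ x = x / n := by
  rw [map_inv, Equiv.Perm.inv_eq_iff_eq, phi_t]; field_simp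

lemma phi_az (n : ℕ) (hn : (n : ℚ) ≠ 0) (z : ℤ) (x : ℚ) : phi n hn (bsA n ^ z) x = z + x := by
  induction z generalizing x with
  | zero => simp
  | succ k ih => rw [zpow_add_one, map_mul, Equiv.Perm.mul_apply, ih, phi_a]; push_cast; ring
  | pred k ih => rw [zpow_sub_one, map_mul, Equiv.Perm.mul_apply, ih, phi_ai]; push_cast; ring

lemma phi_tz (n : ℕ) (hn : (n : ℚ) ≠ 0) (z : ℤ) (x : ℚ) :
    phi n hn (bsT n ^ z) x = (n : ℚ) ^ z * x := by
  induction z generalizing x with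
  | zero => simp
  | succ k ih =>
    rw [zpow_add_one, map_mul, Equiv.Perm.mul_apply, ih, phi_t, zpow_add_one₀ hn]; ring
  | pred k ih =>
    rw [zpow_sub_one, map_mul, Equiv.Perm.mul_apply, ih, phi_ti, zpow_sub_one₀ hn]; field_simp

lemma l1D_add_single (f : ℕ →₀ ℤ) (i : ℕ) (c : ℤ) :
    l1D (f + Finsupp.single i c) ≤ l1D f + c.natAbs := by
  set N := kIdx f + i + 1
  have hk : kIdx (f + Finsupp.single i c) < N := by
    refine Nat.lt_succ_of_le (kIdx_le fun j hj => ?_)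
    have h1 : i ≠ j := by omega
    simp [Finsupp.single_apply, h1, eq_zero_of_kIdx_lt (x := f) (j := j) (by omega)]
  rw [l1D_range hk, l1D_range (x := f) (N := N) (by omega)]
  have : c.natAbs = ∑ j ∈ Finset.range N, (Finsupp.single i c j).natAbs := by
    rw [Finset.sum_eq_single i]
    · simp
    · intro b _ hb; simp [Finsupp.single_apply, hb.symm]
    · intro h; simp at h; omega
  rw [this, ← Finset.sum_add_distrib]
  exact Finset.sum_le_sum fun j _ => by simpa using Int.natAbs_add_le _ _

/-- invariant of a word read from height `s` -/
def Inv (n : ℕ) (hn : (n : ℚ) ≠ 0) (g : BS n) (L : ℕ) (s : ℤ) : Prop :=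
  ∃ (e lo hi : ℤ) (f : ℕ →₀ ℤ) (q : ℚ) (c : ℕ),
    lo ≤ s ∧ lo ≤ e ∧ s ≤ hi ∧ e ≤ hi ∧ (∀ j, f j ≠ 0 → lo ≤ j ∧ (j : ℤ) ≤ hi) ∧
    |q| ≤ c ∧ (0 ≤ lo → c = 0) ∧
    (∀ x : ℚ, (n : ℚ) ^ s * phi n hn g x = (n : ℚ) ^ e * x + sigmaD n f + q) ∧
    ((l1D f + c : ℕ) : ℤ) + min ((s - lo) + (hi - lo) + (hi - e)) ((hi - s) + (hi - lo) + (e - lo)) ≤ L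

lemma Inv_a (n : ℕ) (hn : (n : ℚ) ≠ 0) (g : BS n) (L : ℕ) (s : ℤ) (h : Inv n hn g L s)
    (b : BS n) (ε : ℤ) (hε : ε.natAbs = 1) (hb : ∀ x, phi n hn b x = ε + x) :
    Inv n hn (b * g) (L + 1) s := by
  obtain ⟨e, lo, hi, f, q, c, h1, h2, h3, h4, h5, h6, h7, h8, h9⟩ := h
  rcases le_or_gt 0 s with hs | hs
  · obtain ⟨m, rfl⟩ := Int.eq_ofNat_of_zero_le hs
    refine ⟨e, lo, hi, f + Finsupp.single m ε, q, c, h1, h2, h3, h4, ?_, h6, h7, ?_, ?_⟩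
    · intro j hj
      by_cases hjm : m = j
      · subst hjm; exact ⟨h1, h3⟩
      · apply h5
        simpa [Finsupp.single_apply, hjm] using hj
    · intro x
      rw [map_mul, Equiv.Perm.mul_apply, hb, mul_add, h8, sigmaD_add, sigmaD_single]
      push_cast
      rw [zpow_natCast]; ring
    · have := l1D_add_single f m ε
      push_cast at h9 ⊢
      omega
  · refine ⟨e, lo, hi, f, q + ε * (n : ℚ) ^ s, c + 1, h1, h2, h3, h4, h5, ?_, by omega, ?_, ?_⟩
    · have e1 : |(ε : ℚ)| = 1 := by
        rw [← Int.cast_abs, Int.abs_eq_natAbs, hε]; simp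
      have hn1 : (1 : ℚ) ≤ n := by
        have : n ≠ 0 := by rintro rfl; simp at hn
        exact_mod_cast Nat.one_le_iff_ne_zero.2 this
      have e2 : |(n : ℚ) ^ s| ≤ 1 := by
        rw [abs_of_nonneg (by positivity)]
        exact zpow_le_one_of_nonpos₀ hn1 hs.le
      calc |q + ε * (n : ℚ) ^ s| ≤ |q| + |ε * (n : ℚ) ^ s| := abs_add_le _ _
        _ ≤ c + 1 := by rw [abs_mul, e1, one_mul]; exact add_le_add h6 e2
        _ = _ := by push_cast; ring
    · intro x
      rw [map_mul, Equiv.Perm.mul_apply, hb, mul_add, h8]; ring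
    · push_cast at h9 ⊢
      omega

lemma Inv_t (n : ℕ) (hn : (n : ℚ) ≠ 0) (g : BS n) (L : ℕ) (s : ℤ) (ε : ℤ) (hε : ε.natAbs = 1)
    (h : Inv n hn g L (s + ε)) : Inv n hn (bsT n ^ ε * g) (L + 1) s := by
  obtain ⟨e, lo, hi, f, q, c, h1, h2, h3, h4, h5, h6, h7, h8, h9⟩ := h
  refine ⟨e, min lo s, max hi s, f, q, c, by omega, by omega, by omega, by omega, ?_, h6, ?_, ?_, ?_⟩
  · intro j hj
    have := h5 j hj
    omega
  · intro h; exact h7 (by omega)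
  · intro x
    rw [map_mul, Equiv.Perm.mul_apply, phi_tz, ← mul_assoc, ← zpow_add₀ hn, h8]
  · push_cast at h9 ⊢
    omega

lemma Inv_word (n : ℕ) (hn : (n : ℚ) ≠ 0) (wd : List Letter) (s : ℤ) :
    Inv n hn (evalWord n wd) wd.length s := by
  induction wd generalizing s with
  | nil =>
    refine ⟨s, s, s, 0, 0, 0, le_rfl, le_rfl, le_rfl, le_rfl, by simp, by simp, by simp, ?_, ?_⟩
    · intro x; simp [evalWord, sigmaD]
    · simp [l1D]
  | cons l wd ih =>
    have hc : evalWord n (l :: wd) = evalLetter n l * evalWord n wd := by simp [evalWord]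
    rw [hc, List.length_cons]
    obtain ⟨i, b⟩ := l
    by_cases hi : i = 0
    · cases b
      · exact Inv_a n hn _ _ s (ih s) _ (-1) rfl (by
          intro x; simp only [evalLetter, hi, cond_false, if_true, phi_ai]; push_cast; rfl)
      · exact Inv_a n hn _ _ s (ih s) _ 1 rfl (by
          intro x; simp only [evalLetter, hi, cond_true, if_true, phi_a]; push_cast; rfl)
    · cases b
      · have := Inv_t n hn _ _ s (-1) rfl (ih _)
        simpa [evalLetter, hi] using this
      · have := Inv_t n hn _ _ s 1 rfl (ih _)
        simpa [evalLetter, hi] using this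

lemma lower (n : ℕ) (hn : 2 ≤ n) (u w : ℕ) (v : ℤ) (hd : (n : ℤ) ∣ v → u * w = 0)
    (wd : List Letter)
    (hw : evalWord n wd = bsT n ^ (-(u : ℤ)) * bsA n ^ v * bsT n ^ (w : ℤ)) :
    ∃ y : ℕ →₀ ℤ, sigmaD n y = v ∧ etaLen u w y ≤ wd.length := by
  have hn0 : (n : ℚ) ≠ 0 := by
    have : n ≠ 0 := by omega
    exact_mod_cast this
  obtain ⟨e, lo, hi, f, q, c, h1, h2, h3, h4, h5, h6, h7, h8, h9⟩ := Inv_word n hn0 wd u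
  have h8' : ∀ x : ℚ, v + (n : ℚ) ^ (w : ℤ) * x = (n : ℚ) ^ e * x + sigmaD n f + q := by
    intro x
    rw [← h8, hw, map_mul, map_mul, Equiv.Perm.mul_apply, Equiv.Perm.mul_apply, phi_tz, phi_tz,
      phi_az, ← mul_assoc, ← zpow_add₀ hn0]
    simp
  have hv0 : (v : ℚ) = sigmaD n f + q := by simpa using h8' 0
  have hew : e = w := by
    have h := h8' 1
    have h' : (n : ℚ) ^ (w : ℤ) = (n : ℚ) ^ e := by linarith
    have hn1 : (1 : ℚ) < n := by exact_mod_cast (by omega : 1 < n)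
    exact ((zpow_right_strictMono₀ hn1).injective h').symm
  subst hew
  obtain ⟨m, hm⟩ : ∃ m : ℤ, m = v - sigmaD n f := ⟨_, rfl⟩
  have hq : q = m := by rw [hm]; push_cast; linarith
  have hmc : m.natAbs ≤ c := by
    rw [hq, ← Int.cast_abs, Int.abs_eq_natAbs] at h6
    exact_mod_cast h6
  have hlo : lo ≤ 0 := by
    by_contra hlo
    have hc := h7 (by omega)
    have hdv : (n : ℤ) ∣ v := by
      have : v = sigmaD n f := by omega
      rw [this]
      refine Finset.dvd_sum fun j hj => ?_
      have := h5 j (Finsupp.mem_support_iff.1 hj)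
      exact Dvd.dvd.mul_left (dvd_pow_self _ (by omega)) _
    rcases Nat.mul_eq_zero.1 (hd hdv) with h | h <;> omega
  refine ⟨f + Finsupp.single 0 m, ?_, ?_⟩
  · rw [sigmaD_add, sigmaD_single, hm]; simp
  · have hl := l1D_add_single f 0 m
    have hk : kIdx (f + Finsupp.single 0 m) ≤ hi.toNat := by
      refine kIdx_le fun j hj => ?_
      have h0 : 0 ≠ j := by omega
      by_contra hne
      have := h5 j (by simpa [Finsupp.single_apply, h0] using hne)
      omega
    rw [etaLen_eq]
    push_cast at h9
    omega

end RB

/-- Every `x ∈ L_v` not in the box `B_v^{u,w}` can be reduced into the box by adding an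
element of `L_0` without increasing `|η_{u,v,w}(·)|`; consequently a vector minimal within
the box yields a geodesic word for `t^{-u} a^v t^w`. -/
theorem reduce_to_box (n : ℕ) (hn : 2 ≤ n) (u w : ℕ) (v : ℤ) (hv : v ≠ 0) :
    (∀ x : ℕ →₀ ℤ, sigmaD n x = v → x ∉ BoxSet n u w v →
      ∃ z : ℕ →₀ ℤ, sigmaD n z = 0 ∧ (x + z) ∈ BoxSet n u w v ∧
        etaLen u w (x + z) ≤ etaLen u w x) ∧
    (((n : ℤ) ∣ v → u * w = 0) →
      ∀ x ∈ BoxSet n u w v, (∀ y ∈ BoxSet n u w v, etaLen u w x ≤ etaLen u w y) →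
        wordLength n (bsT n ^ (-(u : ℤ)) * bsA n ^ v * bsT n ^ (w : ℤ)) = etaLen u w x) := by
  refine ⟨fun x hx _ => ?_, fun hd x hx hmin => ?_⟩
  · obtain ⟨y, hy, hle⟩ := RB.part1 n hn u w v x hx
    refine ⟨y - x, ?_, ?_, ?_⟩
    · have h := RB.sigmaD_add n x (y - x)
      rw [add_sub_cancel, hx, hy.1] at h
      omega
    · rwa [add_sub_cancel]
    · rwa [add_sub_cancel]
  · have hup := RB.upper n u w x
    rw [hx.1] at hup
    apply le_antisymm
    · exact Nat.sInf_le hup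
    · obtain ⟨wd, h1, h2⟩ := Nat.sInf_mem (s := {N : ℕ | ∃ wd : List Letter, evalWord n wd =
        bsT n ^ (-(u : ℤ)) * bsA n ^ v * bsT n ^ (w : ℤ) ∧ wd.length = N}) ⟨_, hup⟩
      unfold wordLength
      rw [← h2]
      obtain ⟨y, hy, hle⟩ := RB.lower n hn u w v hd wd h1
      obtain ⟨z, hz, hzle⟩ := RB.part1 n hn u w v y hy
      exact (hmin z hz).trans (hzle.trans hle)
end

section
/- Let n ≥ 3 be odd, let u, w ≥ 0 be integers and v ∈ ℤ with v ≠ 0. (1) If x ∈ B_v^{u,w} satisfies k_x < max(u,w), then B_v^{u,w} = {x}. (2) In all cases B_v^{u,w} contains at most two elements, and if it contains exactly two then B_v^{u,w} = {x, x + ε·w^{(k_x)}} for some x and some ε ∈ {−1, 1}. Moreover, a vector y ∈ B_v^{u,w} fails to be minimal if and only if k_y > max(u,w) and (y_{k_y−1}, y_{k_y}) = (δ·⌊n/2⌋, −δ) for some δ ∈ {−1, 1}. -/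
noncomputable def shD (x : ℕ →₀ ℤ) : ℕ →₀ ℤ := x.comapDomain Nat.succ Nat.succ_injective.injOn

@[simp] lemma shD_apply (x : ℕ →₀ ℤ) (i : ℕ) : shD x i = x (i+1) := by
  simp [shD, Finsupp.comapDomain_apply]

noncomputable def consD (a : ℤ) (x : ℕ →₀ ℤ) : ℕ →₀ ℤ := Finsupp.single 0 a + x.mapDomain Nat.succ

@[simp] lemma consD_zero (a : ℤ) (x : ℕ →₀ ℤ) : consD a x 0 = a := by
  have : x.mapDomain Nat.succ 0 = 0 := Finsupp.mapDomain_of_notMem_range _ _ (by simp)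
  simp [consD, this]

@[simp] lemma consD_succ (a : ℤ) (x : ℕ →₀ ℤ) (i : ℕ) : consD a x (i+1) = x i := by
  have : x.mapDomain Nat.succ (i+1) = x i := Finsupp.mapDomain_apply Nat.succ_injective x i
  simp [consD, this]

@[simp] lemma shD_consD (a : ℤ) (x : ℕ →₀ ℤ) : shD (consD a x) = x := by
  ext i; simp

lemma consD_shD (x : ℕ →₀ ℤ) : consD (x 0) (shD x) = x := by
  ext i; cases i <;> simp

lemma sigmaD_add (n : ℕ) (x y : ℕ →₀ ℤ) : sigmaD n (x + y) = sigmaD n x + sigmaD n y := by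
  unfold sigmaD
  exact Finsupp.sum_add_index' (by simp) (by intros; ring)

lemma sigmaD_single (n i : ℕ) (a : ℤ) : sigmaD n (Finsupp.single i a) = a * (n:ℤ)^i := by
  unfold sigmaD
  exact Finsupp.sum_single_index (by simp)

lemma l1D_single (i : ℕ) (a : ℤ) : l1D (Finsupp.single i a) = a.natAbs := by
  unfold l1D
  exact Finsupp.sum_single_index (by simp)

lemma sigmaD_rec (n : ℕ) (x : ℕ →₀ ℤ) : sigmaD n x = x 0 + n * sigmaD n (shD x) := by
  conv_lhs => rw [← consD_shD x, consD, sigmaD_add, sigmaD_single]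
  have : sigmaD n ((shD x).mapDomain Nat.succ) = n * sigmaD n (shD x) := by
    unfold sigmaD
    rw [Finsupp.sum_mapDomain_index (by simp) (by intros; ring), Finsupp.mul_sum]
    refine Finsupp.sum_congr ?_
    intros; rw [Nat.succ_eq_add_one]; ring
  rw [this]; simp

lemma l1D_eq (x : ℕ →₀ ℤ) (s : Finset ℕ) (h : x.support ⊆ s) : l1D x = ∑ i ∈ s, (x i).natAbs :=
  Finsupp.sum_of_support_subset x h _ (by simp)

lemma l1D_rec (x : ℕ →₀ ℤ) : l1D x = (x 0).natAbs + l1D (shD x) := by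
  have h : ∀ i, x.support.sup id < i → x i = 0 := by
    intro i hi
    by_contra h
    have := Finset.le_sup (f := id) (Finsupp.mem_support_iff.2 h)
    simp at this; omega
  have h1 : x.support ⊆ Finset.range (x.support.sup id + 2) := by
    intro i hi; simp at hi ⊢; by_contra h'; exact hi (h i (by omega))
  have h2 : (shD x).support ⊆ Finset.range (x.support.sup id + 1) := by
    intro i hi; simp at hi ⊢; by_contra h'; exact hi (h (i+1) (by omega))
  rw [l1D_eq x _ h1, l1D_eq _ _ h2, Finset.sum_range_succ']
  simp; ring

lemma kIdx_le (x : ℕ →₀ ℤ) (N : ℕ) (h : ∀ i, N < i → x i = 0) : kIdx x ≤ N := by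
  unfold kIdx
  refine Finset.sup_le ?_
  intro i hi; simp at hi ⊢; by_contra h'; exact hi (h i (by omega))

lemma le_kIdx (x : ℕ →₀ ℤ) (i : ℕ) (h : x i ≠ 0) : i ≤ kIdx x := 
  Finset.le_sup (f := id) (Finsupp.mem_support_iff.2 h)

lemma kIdx_ne (x : ℕ →₀ ℤ) (h : x ≠ 0) : x (kIdx x) ≠ 0 := by
  have : x.support.Nonempty := by simpa using h
  obtain ⟨i, hi, h2⟩ := Finset.exists_mem_eq_sup x.support this id
  unfold kIdx; rw [h2]; simpa using hi

lemma sh0 {x : ℕ →₀ ℤ} (h : shD x = 0) : x = Finsupp.single 0 (x 0) := by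
  rw [← consD_shD x, h]; simp [consD]

lemma kIdx_sh0 {x : ℕ →₀ ℤ} (h : shD x = 0) : kIdx x = 0 := by
  have := kIdx_le x 0 (by
    intro i hi
    obtain ⟨j, rfl⟩ : ∃ j, i = j+1 := ⟨i-1, by omega⟩
    rw [← shD_apply, h]; rfl)
  omega

lemma kIdx_sh {x : ℕ →₀ ℤ} (h : shD x ≠ 0) : kIdx x = kIdx (shD x) + 1 := by
  apply le_antisymm
  · apply kIdx_le
    intro i hi
    obtain ⟨j, rfl⟩ : ∃ j, i = j+1 := ⟨i-1, by omega⟩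
    by_contra h'
    have := le_kIdx (shD x) j (by simpa using h')
    omega
  · apply le_kIdx
    rw [← shD_apply]; exact kIdx_ne _ h

lemma l1D_zero : l1D 0 = 0 := by simp [l1D]
lemma sigmaD_zero (n : ℕ) : sigmaD n 0 = 0 := by simp [sigmaD]
lemma shD_zero : shD 0 = 0 := by ext; simp

lemma l1D_pos {x : ℕ →₀ ℤ} (h : x ≠ 0) : 1 ≤ l1D x := by
  have := kIdx_ne x h
  have h2 : (x (kIdx x)).natAbs ≤ l1D x := by
    unfold l1D Finsupp.sum
    exact Finset.single_le_sum (f := fun i => (x i).natAbs) (by simp) (by simpa using this)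
  omega

lemma eq_of_sh {x y : ℕ →₀ ℤ} (h0 : x 0 = y 0) (h : shD x = shD y) : x = y := by
  rw [← consD_shD x, ← consD_shD y, h0, h]

def BxD (m M : ℕ) (x : ℕ →₀ ℤ) : Prop :=
  (∀ i < kIdx x, |x i| ≤ (m : ℤ)) ∧ (kIdx x < M → |x (kIdx x)| ≤ (m:ℤ)) ∧
    |x (kIdx x)| ≤ (m:ℤ) + 1

lemma BxD_sh {m M : ℕ} {x : ℕ →₀ ℤ} (hx : BxD m M x) (h : shD x ≠ 0) :
    |x 0| ≤ (m:ℤ) ∧ BxD m (M-1) (shD x) := by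
  have hk := kIdx_sh h
  obtain ⟨h1, h2, h3⟩ := hx
  rw [hk] at h1 h2 h3
  refine ⟨h1 0 (by omega), ?_, ?_, ?_⟩
  · intro i hi; simpa using h1 (i+1) (by omega)
  · intro hi; simpa using h2 (by omega)
  · simpa using h3

lemma BxD_sh0 {m M : ℕ} {x : ℕ →₀ ℤ} (hx : BxD m M x) (h : shD x = 0) :
    |x 0| ≤ (m:ℤ) + 1 ∧ (0 < M → |x 0| ≤ (m:ℤ)) := by
  have hk := kIdx_sh0 h
  obtain ⟨h1, h2, h3⟩ := hx
  rw [hk] at h1 h2 h3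
  exact ⟨h3, h2⟩

lemma sh_induct {P : (ℕ →₀ ℤ) → Prop} (h0 : ∀ x, shD x = 0 → P x)
    (h1 : ∀ x, shD x ≠ 0 → P (shD x) → P x) (x : ℕ →₀ ℤ) : P x := by
  induction hk : kIdx x generalizing x with
  | zero =>
    by_cases h : shD x = 0
    · exact h0 x h
    · have := kIdx_sh h; omega
  | succ k ih =>
    by_cases h : shD x = 0
    · exact h0 x h
    · exact h1 x h (ih _ (by have := kIdx_sh h; omega))

lemma mul_small {n : ℤ} {s a : ℤ} (h : |n * s| ≤ a) (h2 : a < 2 * n) (hn : 0 < n) :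
    s = 0 ∨ s = 1 ∨ s = -1 := by
  have h3 := abs_le.1 h
  have : s < 2 := by by_contra h'; nlinarith
  have : -2 < s := by by_contra h'; nlinarith
  omega

lemma mul_small' {n : ℤ} {s a : ℤ} (h : |n * s| ≤ a) (h2 : a < n) (hn : 0 < n) :
    s = 0 := by
  have h3 := abs_le.1 h
  have : s < 1 := by by_contra h'; nlinarith
  have : -1 < s := by by_contra h'; nlinarith
  omega

lemma Bx_zero {n m : ℕ} (hm : 1 ≤ m) (hnm : n = 2*m+1) (x : ℕ →₀ ℤ) :
    ∀ M, BxD m M x → sigmaD n x = 0 → x = 0 := by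
  induction x using sh_induct with
  | h0 x h =>
    intro M hx hs
    rw [sh0 h, sigmaD_single] at hs
    rw [sh0 h]
    simp at hs; simp [hs]
  | h1 x h ih =>
    intro M hx hs
    obtain ⟨h1, h2⟩ := BxD_sh hx h
    rw [sigmaD_rec] at hs
    have : (sigmaD n (shD x)) = 0 := by
      refine mul_small' (n := n) (a := m) ?_ (by omega) (by omega)
      have : (n:ℤ) * sigmaD n (shD x) = - x 0 := by linarith
      rw [this, abs_neg]; exact h1
    exact absurd (ih _ h2 this) h

lemma Bx_one {n m : ℕ} (hm : 1 ≤ m) (hnm : n = 2*m+1) (x : ℕ →₀ ℤ) (M : ℕ) (hx : BxD m M x)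
    (ε : ℤ) (hε : ε = 1 ∨ ε = -1) (hs : sigmaD n x = ε) : x = Finsupp.single 0 ε := by
  by_cases h : shD x = 0
  · rw [sh0 h, sigmaD_single] at hs
    rw [sh0 h]
    simp at hs; simp [hs]
  · obtain ⟨h1, h2⟩ := BxD_sh hx h
    rw [sigmaD_rec] at hs
    have : (sigmaD n (shD x)) = 0 := by
      refine mul_small' (n := n) (a := m+1) ?_ (by omega) (by omega)
      have : (n:ℤ) * sigmaD n (shD x) = ε - x 0 := by linarith
      rw [this]; rw [abs_le] at *; omega
    exact absurd (Bx_zero hm hnm _ _ h2 this) h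

lemma lemA {n m : ℕ} (hm : 1 ≤ m) (hnm : n = 2*m+1) (x : ℕ →₀ ℤ) :
    ∀ M y, BxD m M x → BxD m M y → sigmaD n x = sigmaD n y → kIdx x ≤ kIdx y → x = y ∨
      (M ≤ kIdx x ∧ kIdx y = kIdx x + 1 ∧ ∃ ε : ℤ, (ε = 1 ∨ ε = -1) ∧ x (kIdx x) = ε * (m+1) ∧
        y = x + ε • wVec n (kIdx x)) := by
  induction x using sh_induct with
  | h0 x h =>
    intro M y hx hy hs hk
    obtain ⟨h1, h2⟩ := BxD_sh0 hx h
    have hkx := kIdx_sh0 h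
    by_cases hy0 : shD y = 0
    · left
      refine eq_of_sh ?_ (by rw [h, hy0])
      rw [sh0 h, sh0 hy0, sigmaD_single, sigmaD_single] at hs
      simpa using hs
    · obtain ⟨h3, h4⟩ := BxD_sh hy hy0
      have hky := kIdx_sh hy0
      rw [sh0 h, sigmaD_single, sigmaD_rec n y] at hs
      simp only [pow_zero, mul_one] at hs
      have hs' : (n:ℤ) * sigmaD n (shD y) = x 0 - y 0 := by linarith
      have key : sigmaD n (shD y) = 0 ∨ sigmaD n (shD y) = 1 ∨ sigmaD n (shD y) = -1 := by
        refine mul_small (n := n) (a := 2*m+1) ?_ (by omega) (by omega)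
        rw [hs']; rw [abs_le] at *; omega
      rcases key with key | key
      · exact absurd (Bx_zero hm hnm _ _ h4 key) hy0
      · right
        obtain ⟨ε, hε⟩ : ∃ ε, ε = sigmaD n (shD y) := ⟨_, rfl⟩
        rw [← hε] at key
        have hone := Bx_one hm hnm _ _ h4 ε key hε.symm
        rw [← hε] at hs'
        rw [abs_le] at h1 h3
        have hx0 : x 0 = ε * (m+1) := by
          rcases key with rfl | rfl <;> push_cast [hnm] at hs' <;> linarith
        have hM : M = 0 := by
          by_contra h'
          have := h2 (by omega)
          rw [abs_le] at this
          rcases key with rfl | rfl <;> omega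
        have hk1 : kIdx (shD y) = 0 := by
          have := kIdx_le (shD y) 0 (by intro i hi; rw [hone, Finsupp.single_apply, if_neg (by omega)])
          omega
        rw [hkx]
        refine ⟨by omega, by omega, ε, key, hx0, ?_⟩
        apply eq_of_sh
        · simp [wVec]; linarith
        · rw [hone]; ext i
          have : x (i+1) = 0 := by rw [← shD_apply, h]; rfl
          simp [wVec, this, Finsupp.single_apply, eq_comm]
  | h1 x h ih =>
    intro M y hx hy hs hk
    obtain ⟨h1, h2⟩ := BxD_sh hx h
    have hkx := kIdx_sh h
    have hy0 : shD y ≠ 0 := by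
      intro h'; have := kIdx_sh0 h'; omega
    obtain ⟨h3, h4⟩ := BxD_sh hy hy0
    have hky := kIdx_sh hy0
    rw [sigmaD_rec n x, sigmaD_rec n y] at hs
    have key : sigmaD n (shD x) - sigmaD n (shD y) = 0 := by
      refine mul_small' (n := n) (a := 2*m) ?_ (by omega) (by omega)
      have : (n:ℤ) * (sigmaD n (shD x) - sigmaD n (shD y)) = y 0 - x 0 := by linarith
      rw [this]; rw [abs_le] at *; omega
    have key' : sigmaD n (shD x) = sigmaD n (shD y) := by linarith
    have h00 : x 0 = y 0 := by rw [key'] at hs; linarith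
    rcases ih (M-1) (shD y) h2 h4 key' (by omega) with h5 | ⟨h5, h6, ε, hε, h7, h8⟩
    · left; exact eq_of_sh h00 h5
    · right
      refine ⟨by omega, by omega, ε, hε, ?_, ?_⟩
      · rw [hkx, ← h7, shD_apply]
      · apply eq_of_sh
        · simp [wVec, h00, hkx]
        · rw [h8, hkx]; ext i; simp [wVec, Finsupp.single_apply]

def fD (M : ℕ) (x : ℕ →₀ ℤ) : ℕ := l1D x + 2 * (kIdx x - M)

lemma etaLen_eq (u w : ℕ) (x : ℕ →₀ ℤ) : etaLen u w x = fD (max u w) x + u + w := by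
  unfold etaLen fD
  rcases le_total u w with h | h
  · rw [max_eq_right h, if_pos (Or.inr h)]; omega
  · rw [max_eq_left h]; split_ifs <;> omega

def BadD (m M : ℕ) (y : ℕ →₀ ℤ) : Prop :=
  M < kIdx y ∧ ∃ δ : ℤ, (δ = 1 ∨ δ = -1) ∧ y (kIdx y - 1) = δ * (m : ℤ) ∧ y (kIdx y) = -δ

lemma BadD_sh {m M : ℕ} {y : ℕ →₀ ℤ} (h : shD y ≠ 0) (hb : BadD m (M-1) (shD y)) :
    BadD m M y := by
  obtain ⟨h1, δ, hδ, h2, h3⟩ := hb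
  have hk := kIdx_sh h
  refine ⟨by omega, δ, hδ, ?_, ?_⟩
  · rw [← h2, hk, shD_apply]; congr 1; omega
  · rw [← h3, hk, shD_apply]

lemma BadD_sh' {m M : ℕ} {y : ℕ →₀ ℤ} (h : shD (shD y) ≠ 0) (hb : BadD m M y) :
    BadD m (M-1) (shD y) := by
  obtain ⟨h1, δ, hδ, h2, h3⟩ := hb
  have hk' := kIdx_sh h
  have hk := kIdx_sh (x := y) (by intro h'; rw [h', shD_zero] at h; exact h rfl)
  refine ⟨by omega, δ, hδ, ?_, ?_⟩
  · rw [← h2, hk, shD_apply]; congr 1; omega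
  · rw [← h3, hk, shD_apply]

lemma bad_not_min {n m : ℕ} (hm : 1 ≤ m) (hnm : n = 2*m+1) (y : ℕ →₀ ℤ) :
    ∀ M, BadD m M y → ∃ z, sigmaD n z = sigmaD n y ∧ fD M z < fD M y := by
  induction y using sh_induct with
  | h0 y h =>
    intro M hb
    have := hb.1
    have := kIdx_sh0 h
    omega
  | h1 y h ih =>
    intro M hb
    have hk := kIdx_sh h
    by_cases h' : shD (shD y) = 0
    · obtain ⟨h1, δ, hδ, h2, h3⟩ := hb
      have hk' := kIdx_sh0 h'
      rw [hk, hk'] at h1 h2 h3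
      simp at h2 h3 h1
      refine ⟨Finsupp.single 0 (y 0 - n * δ), ?_, ?_⟩
      · rw [sigmaD_single, sigmaD_rec n y, sigmaD_rec n (shD y), h', sigmaD_zero]
        simp [h3]; ring
      · have hkz : kIdx (Finsupp.single 0 (y 0 - n * δ)) = 0 := by
          have := kIdx_le (Finsupp.single 0 (y 0 - n * δ)) 0 (by intro i hi; rw [Finsupp.single_apply, if_neg (by omega)])
          omega
        unfold fD
        rw [l1D_single, hkz, l1D_rec y, l1D_rec (shD y), h', l1D_zero, hk, hk', shD_apply, h3, h2, hnm]
        rcases hδ with rfl | rfl <;> push_cast <;> omega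
    · obtain ⟨z, hz, hf⟩ := ih _ (BadD_sh' h' hb)
      have hM := hb.1
      have hM' := (BadD_sh' h' hb).1
      refine ⟨consD (y 0) z, ?_, ?_⟩
      · rw [sigmaD_rec, sigmaD_rec n y]; simp [hz]
      · have hkc : kIdx (consD (y 0) z) ≤ kIdx z + 1 := by
          by_cases h0 : z = 0
          · rw [kIdx_sh0 (by simpa using h0)]; omega
          · have := kIdx_sh (x := consD (y 0) z) (by simpa using h0)
            simp at this; omega
        unfold fD at *
        rw [l1D_rec, l1D_rec y]
        simp only [shD_consD, consD_zero]
        omega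

lemma good_min {n m : ℕ} (hm : 1 ≤ m) (hnm : n = 2*m+1) (y : ℕ →₀ ℤ) :
    ∀ M, BxD m M y → ¬ BadD m M y → ∀ z, sigmaD n z = sigmaD n y → fD M y ≤ fD M z := by
  induction y using sh_induct with
  | h0 y h =>
    intro M hy hb z hz
    have hk := kIdx_sh0 h
    obtain ⟨h1, h2⟩ := BxD_sh0 hy h
    have hfy : fD M y = (y 0).natAbs := by
      unfold fD; rw [hk, l1D_rec, h, l1D_zero]; omega
    rw [hfy]
    unfold fD
    rw [l1D_rec z]
    rw [sigmaD_rec n z, sigmaD_rec n y, h, sigmaD_zero] at hz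
    by_cases hz0 : shD z = 0
    · rw [hz0, sigmaD_zero] at hz
      have : z 0 = y 0 := by linarith
      rw [this]; omega
    · have := l1D_pos hz0
      rcases lt_trichotomy (sigmaD n (shD z)) 0 with hc | hc | hc
      · have : (n:ℤ) * sigmaD n (shD z) ≤ - n := by nlinarith
        rw [abs_le] at h1
        omega
      · rw [hc] at hz
        have : z 0 = y 0 := by linarith
        rw [this]; omega
      · have : (n:ℤ) ≤ (n:ℤ) * sigmaD n (shD z) := by nlinarith
        rw [abs_le] at h1
        omega
  | h1 y h ih =>
    intro M hy hb z hz
    have hk := kIdx_sh h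
    obtain ⟨h1, h2⟩ := BxD_sh hy h
    have IH := ih _ h2 (fun h' => hb (BadD_sh h h'))
    rw [sigmaD_rec n z, sigmaD_rec n y] at hz
    obtain ⟨c, hc⟩ : ∃ c, c = sigmaD n (shD y) - sigmaD n (shD z) := ⟨_, rfl⟩
    have hz' : z 0 = y 0 + n * c := by rw [hc]; linarith
    by_cases hM : M = 0 ∧ shD z = 0
    · obtain ⟨rfl, hz0⟩ := hM
      have hkz := kIdx_sh0 hz0
      rw [hz0, sigmaD_zero, sub_zero] at hc
      have hI := IH (Finsupp.single 0 c) (by rw [sigmaD_single, hc]; simp)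
      have hks : kIdx (Finsupp.single 0 c) = 0 := by
        have := kIdx_le (Finsupp.single 0 c) 0 (by intro i hi; rw [Finsupp.single_apply, if_neg (by omega)])
        omega
      have hpos := l1D_pos h
      unfold fD at *
      rw [hks, l1D_single] at hI
      rw [l1D_rec y, l1D_rec z, hz0, l1D_zero, hkz, hk]
      rw [abs_le] at h1
      have hc0 : c ≠ 0 := by
        intro h0; rw [h0] at hI; simp at hI; omega
      have hcase : c = 1 ∨ c = -1 ∨ 2 ≤ c ∨ c ≤ -2 := by omega
      have hone : (c = 1 ∨ c = -1) → y 0 ≠ -c * m := by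
        intro hc1 hy0
        have hs := Bx_one hm hnm _ _ h2 c hc1 hc.symm
        have hk0 : kIdx (shD y) = 0 := by rw [hs]; exact hks
        refine hb ⟨by omega, -c, by omega, ?_, ?_⟩
        · rw [hk, hk0]; exact hy0
        · rw [hk, ← shD_apply, hk0, hs]; simp
      rcases hcase with rfl | rfl | hc2 | hc2
      · have := hone (by simp)
        omega
      · have := hone (by simp)
        omega
      · have : (n:ℤ) * c = 2 * (m * c) + c := by rw [hnm]; push_cast; ring
        have : (m:ℤ) * c ≥ 2 * m := by nlinarith
        omega
      · have : (n:ℤ) * c = 2 * (m * c) + c := by rw [hnm]; push_cast; ring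
        have : (m:ℤ) * c ≤ - 2 * m := by nlinarith
        omega
    · have hI := IH (shD z + Finsupp.single 0 c) (by
        rw [sigmaD_add, sigmaD_single, hc]; ring)
      have hkle : kIdx (shD z + Finsupp.single 0 c) ≤ kIdx (shD z) := by
        apply kIdx_le
        intro i hi
        have : shD z i = 0 := by
          by_contra h'; have := le_kIdx _ _ h'; omega
        rw [Finsupp.add_apply, this, Finsupp.single_apply, if_neg (by omega)]; rfl
      have hl : l1D (shD z + Finsupp.single 0 c) ≤ l1D (shD z) + c.natAbs := by
        rw [l1D_rec, l1D_rec (shD z)]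
        have : shD (shD z + Finsupp.single 0 c) = shD (shD z) := by
          ext i; simp
        rw [this]; simp
        omega
      have h0 : (y 0).natAbs + c.natAbs ≤ (z 0).natAbs := by
        rw [hz']
        rw [abs_le] at h1
        have h3 : (n:ℤ) * c = 2 * (m * c) + c := by rw [hnm]; push_cast; ring
        rcases lt_trichotomy c 0 with hc | hc | hc
        · have : (m:ℤ) * c ≤ - m := by nlinarith
          omega
        · subst hc; simp
        · have : (m:ℤ) * c ≥ m := by nlinarith
          omega
      have hfz : 2 * (kIdx (shD z) - (M-1)) + (if M = 0 then 2 else 0) ≤ 2 * (kIdx z - M) := by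
        by_cases hz0 : shD z = 0
        · have : kIdx (shD z) = 0 := kIdx_sh0 (by rw [hz0, shD_zero])
          rw [this, if_neg (by tauto)]; omega
        · rw [kIdx_sh hz0]; split_ifs <;> omega
      unfold fD at *
      rw [l1D_rec y, l1D_rec z]
      split_ifs at hfz <;> omega

lemma mem_Box {n u w : ℕ} {v : ℤ} (hn : 3 ≤ n) (x : ℕ →₀ ℤ) :
    x ∈ BoxSet n u w v ↔ sigmaD n x = v ∧ BxD (n/2) (max u w) x := by
  unfold BoxSet BxD
  rw [Set.mem_ofPred_eq, if_neg (by omega)]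
  constructor
  · rintro ⟨h1, h2, h3, h4⟩
    refine ⟨h1, h2, h3, ?_⟩
    rcases lt_or_ge (kIdx x) (max u w) with h | h
    · have := h3 h; omega
    · exact h4 h
  · rintro ⟨h1, h2, h3, h4⟩
    exact ⟨h1, h2, h3, fun _ => h4⟩

/-- Structure of the box `B_v^{u,w}` for odd `n ≥ 3`: (1) if some `x ∈ B_v^{u,w}` has
`k_x < max(u,w)` then the box is the singleton `{x}`; (2) the box has at most two
elements, and when it has exactly two it is `{x, x + ε·w^{(k_x)}}` with `ε ∈ {±1}`;
moreover `y ∈ B_v^{u,w}` fails to be minimal iff `k_y > max(u,w)` and its final two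
digits are `(δ·⌊n/2⌋, -δ)` for some `δ ∈ {±1}`. -/
theorem odd_box_structure (n : ℕ) (hn : 3 ≤ n) (hodd : Odd n) (u w : ℕ) (v : ℤ)
    (hv : v ≠ 0) :
    (∀ x ∈ BoxSet n u w v, kIdx x < max u w → BoxSet n u w v = {x}) ∧
    (∀ x y z : ℕ →₀ ℤ, x ∈ BoxSet n u w v → y ∈ BoxSet n u w v → z ∈ BoxSet n u w v →
      x = y ∨ x = z ∨ y = z) ∧
    ((∃ x y : ℕ →₀ ℤ, x ≠ y ∧ BoxSet n u w v = {x, y}) →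
      ∃ (x : ℕ →₀ ℤ) (ε : ℤ), (ε = 1 ∨ ε = -1) ∧
        BoxSet n u w v = {x, x + ε • wVec n (kIdx x)}) ∧
    (∀ y ∈ BoxSet n u w v,
      ¬ IsMinimalVec n u w y ↔
        (max u w < kIdx y ∧ ∃ δ : ℤ, (δ = 1 ∨ δ = -1) ∧
          y (kIdx y - 1) = δ * ((n / 2 : ℕ) : ℤ) ∧ y (kIdx y) = -δ)) := by
  obtain ⟨p, hp⟩ := hodd
  have hm : 1 ≤ n / 2 := by omega
  have hnm : n = 2 * (n / 2) + 1 := by omega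
  have A : ∀ x y, x ∈ BoxSet n u w v → y ∈ BoxSet n u w v → kIdx x ≤ kIdx y → x = y ∨
      (max u w ≤ kIdx x ∧ kIdx y = kIdx x + 1 ∧ ∃ ε : ℤ, (ε = 1 ∨ ε = -1) ∧
        x (kIdx x) = ε * ((n/2 : ℕ)+1) ∧ y = x + ε • wVec n (kIdx x)) := by
    intro x y hx hy hk
    rw [mem_Box hn] at hx hy
    exact lemA hm hnm x _ y hx.2 hy.2 (by rw [hx.1, hy.1]) hk
  refine ⟨?_, ?_, ?_, ?_⟩
  · intro x hx hk
    ext y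
    simp only [Set.mem_singleton_iff]
    constructor
    · intro hy
      rcases le_total (kIdx x) (kIdx y) with h | h
      · rcases A x y hx hy h with h1 | h1
        · exact h1.symm
        · omega
      · rcases A y x hy hx h with h1 | h1
        · exact h1
        · omega
    · rintro rfl; exact hx
  · intro x y z hx hy hz
    have T : ∀ x y, x ∈ BoxSet n u w v → y ∈ BoxSet n u w v →
        x = y ∨ kIdx y = kIdx x + 1 ∨ kIdx x = kIdx y + 1 := by
      intro x y hx hy
      rcases le_total (kIdx x) (kIdx y) with h | h
      · rcases A x y hx hy h with h1 | h1
        · exact Or.inl h1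
        · exact Or.inr (Or.inl h1.2.1)
      · rcases A y x hy hx h with h1 | h1
        · exact Or.inl h1.symm
        · exact Or.inr (Or.inr h1.2.1)
    rcases T x y hx hy with h1 | h1
    · exact Or.inl h1
    rcases T x z hx hz with h2 | h2
    · exact Or.inr (Or.inl h2)
    rcases T y z hy hz with h3 | h3
    · exact Or.inr (Or.inr h3)
    omega
  · rintro ⟨x, y, hne, hB⟩
    have hx : x ∈ BoxSet n u w v := by rw [hB]; simp
    have hy : y ∈ BoxSet n u w v := by rw [hB]; simp
    rcases le_total (kIdx x) (kIdx y) with h | h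
    · rcases A x y hx hy h with h1 | ⟨_, _, ε, hε, _, h1⟩
      · exact absurd h1 hne
      · exact ⟨x, ε, hε, by rw [← h1]; exact hB⟩
    · rcases A y x hy hx h with h1 | ⟨_, _, ε, hε, _, h1⟩
      · exact absurd h1.symm hne
      · exact ⟨y, ε, hε, by rw [← h1, Set.pair_comm]; exact hB⟩
  · intro y hy
    rw [mem_Box hn] at hy
    change _ ↔ BadD (n/2) (max u w) y
    constructor
    · intro h
      by_contra hb
      apply h
      refine ⟨?_, ?_⟩
      · intro z hz
        have := good_min hm hnm y _ hy.2 hb z hz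
        rw [etaLen_eq, etaLen_eq]; omega
      · intro he
        exfalso
        obtain ⟨q, hq⟩ := he
        omega
    · intro hb h
      obtain ⟨z, hz, hf⟩ := bad_not_min hm hnm y _ hb
      have := h.1 z hz
      rw [etaLen_eq, etaLen_eq] at this; omega
end

section
/- Let n ≥ 2 be even, let u, w ≥ 0 be integers and v ∈ ℤ with v ≠ 0, and let x ∈ B_v^{u,w} with k_x < max(u,w). Then x is not minimal if and only if there exist an index i with i < k_x and δ ∈ {−1, 1} such that either (x_i, x_{i+1}) = (δ·(n/2), δ·(n/2)), or x_i = δ·(n/2) and sign(x_{i+1}) = −δ. -/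
namespace EAD

def S (n : ℤ) (N : ℕ) (x : ℕ → ℤ) : ℤ := ∑ i ∈ Finset.range N, x i * n ^ i
def L (N : ℕ) (x : ℕ → ℤ) : ℤ := ∑ i ∈ Finset.range N, |x i|
def T (x : ℕ → ℤ) : ℕ → ℤ := fun i => x (i + 1)

lemma S_succ (n : ℤ) (N : ℕ) (x : ℕ → ℤ) : S n (N + 1) x = x 0 + n * S n N (T x) := by
  unfold S T
  rw [Finset.sum_range_succ', Finset.mul_sum, add_comm]
  congr 1
  · simp
  · apply Finset.sum_congr rfl
    intro i _
    ring

lemma L_succ (N : ℕ) (x : ℕ → ℤ) : L (N + 1) x = |x 0| + L N (T x) := by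
  unfold L T
  rw [Finset.sum_range_succ', add_comm]

structure Good (h : ℤ) (x : ℕ → ℤ) : Prop where
  bd : ∀ i, |x i| ≤ h
  p1 : ∀ i, x i = h → 0 ≤ x (i + 1) ∧ x (i + 1) ≤ h - 1
  p2 : ∀ i, x i = -h → x (i + 1) ≤ 0 ∧ -(h - 1) ≤ x (i + 1)

lemma Good.shift {h : ℤ} {x : ℕ → ℤ} (g : Good h x) : Good h (T x) :=
  ⟨fun i => g.bd (i + 1), fun i => g.p1 (i + 1), fun i => g.p2 (i + 1)⟩

def Lex (N : ℕ) (x y : ℕ → ℤ) : Prop :=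
  (∀ i < N, |x i| = |y i|) ∨ ∃ i : ℕ, (∀ j < i, |x j| = |y j|) ∧ |x i| < |y i|

def A (h : ℤ) (N : ℕ) : Prop := ∀ x y : ℕ → ℤ, Good h x → S (2 * h) N y = S (2 * h) N x →
  L N x ≤ L N y ∧ (L N x = L N y → Lex N x y)

def Q (h : ℤ) (N : ℕ) : Prop := ∀ (x y : ℕ → ℤ) (δ : ℤ), (δ = 1 ∨ δ = -1) → Good h x →
  0 ≤ δ * x 0 → δ * x 0 ≤ h - 1 → S (2 * h) N y = S (2 * h) N x + δ →
  L N x ≤ L N y ∧ |x 0| < |y 0|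

lemma lip {h : ℤ} {N : ℕ} (hA : A h N) (x y : ℕ → ℤ) (c : ℤ) (g : Good h x)
    (hs : S (2 * h) N y = S (2 * h) N x + c) : L N x ≤ L N y + |c| := by
  cases N with
  | zero => simp [L]
  | succ N =>
    let z : ℕ → ℤ := fun i => if i = 0 then y 0 - c else y i
    have hT : T z = T y := by
      funext i; simp [T, z]
    have hz : z 0 = y 0 - c := by simp [z]
    have h1 := (hA x z g (by rw [S_succ, hT, hz]; rw [S_succ] at hs; linarith)).1
    rw [L_succ N z, hT, hz] at h1
    rw [L_succ N y]
    have := abs_sub (y 0) c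
    linarith

lemma carry {h X Y a b c : ℤ} (hh : 1 ≤ h) (e : b + 2 * h * Y = a + 2 * h * X + c)
    : ∃ d, (2 * h) * d = 2 * h * Y - 2 * h * X ∧ Y = X + d ∧ b = a + c - 2 * h * d :=
  ⟨Y - X, by ring, by ring, by linarith⟩

lemma big {h d : ℤ} (hh : 1 ≤ h) :
    d = 0 ∨ d = 1 ∨ d = -1 ∨ (2 ≤ d ∧ 4 * h + 2 * d - 4 ≤ 2 * h * d) ∨
      (d ≤ -2 ∧ 2 * h * d ≤ -(4 * h) + 2 * d + 4) := by
  by_cases h2 : 2 ≤ d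
  · right; right; right; left
    exact ⟨h2, by nlinarith⟩
  by_cases h3 : d ≤ -2
  · right; right; right; right
    exact ⟨h3, by nlinarith⟩
  omega

lemma Qstep {h : ℤ} (hh : 1 ≤ h) {N : ℕ} (hA : A h N) : Q h (N + 1) := by
  intro x y δ hδ g h0 h1 hs
  rw [S_succ, S_succ] at hs
  obtain ⟨d, -, hd, hb⟩ := carry hh hs
  have hl := lip hA (T x) (T y) d g.shift hd
  rw [L_succ, L_succ]
  have := big (d := d) hh
  have bd := g.bd 0
  rcases this with rfl | rfl | rfl | ⟨h2, h3⟩ | ⟨h2, h3⟩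
  · have e : y 0 = x 0 + δ := by linarith
    simp only [abs_zero, add_zero] at hl
    rcases hδ with rfl | rfl
    · have : |y 0| = |x 0| + 1 := by
        rw [e, abs_of_nonneg (by linarith), abs_of_nonneg (by linarith)]
      exact ⟨by linarith, by linarith⟩
    · have : |y 0| = |x 0| + 1 := by
        rw [e, abs_of_nonpos (by linarith), abs_of_nonpos (by linarith)]; ring
      exact ⟨by linarith, by linarith⟩
  · rcases hδ with rfl | rfl <;> grind
  · rcases hδ with rfl | rfl <;> grind
  · generalize 2 * h * d = P at *
    rcases hδ with rfl | rfl <;> grind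
  · generalize 2 * h * d = P at *
    rcases hδ with rfl | rfl <;> grind

lemma Lex.head {x y : ℕ → ℤ} (N : ℕ) (h : |x 0| < |y 0|) : Lex N x y :=
  Or.inr ⟨0, by simp, h⟩

lemma Lex.snd {x y : ℕ → ℤ} (N : ℕ) (h0 : |x 0| = |y 0|) (h : |x 1| < |y 1|) : Lex N x y :=
  Or.inr ⟨1, by intro j hj; obtain rfl : j = 0 := by omega
                exact h0, h⟩

lemma Lex.cons {x y : ℕ → ℤ} {N : ℕ} (h0 : |x 0| = |y 0|) (h : Lex N (T x) (T y)) :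
    Lex (N + 1) x y := by
  rcases h with h | ⟨i, h1, h2⟩
  · left
    intro i hi
    cases i with
    | zero => exact h0
    | succ i => exact h i (by omega)
  · right
    refine ⟨i + 1, ?_, h2⟩
    intro j hj
    cases j with
    | zero => exact h0
    | succ j => exact h1 j (by omega)

lemma Astep {h : ℤ} (hh : 1 ≤ h) {N : ℕ} (hA : A h N) (hQ : Q h N) : A h (N + 1) := by
  intro x y g hs
  have hs' : S (2 * h) (N + 1) y = S (2 * h) (N + 1) x + 0 := by rw [hs, add_zero]
  rw [S_succ, S_succ] at hs'
  obtain ⟨d, -, hd, hb⟩ := carry hh hs'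
  have hl := lip hA (T x) (T y) d g.shift hd
  rw [L_succ, L_succ]
  have bd := abs_le.1 (g.bd 0)
  rcases big (d := d) hh with rfl | rfl | rfl | ⟨h2, h3⟩ | ⟨h2, h3⟩
  · have e : y 0 = x 0 := by linarith
    obtain ⟨a1, a2⟩ := hA (T x) (T y) g.shift (by rw [hd, add_zero])
    rw [e]
    refine ⟨by linarith, fun q => Lex.cons (by rw [e]) (a2 (by linarith))⟩
  · by_cases hx : x 0 = h
    · obtain ⟨b1, b2⟩ := g.p1 0 hx
      obtain ⟨q1, q2⟩ := hQ (T x) (T y) 1 (Or.inl rfl) g.shift (by simpa [T] using b1)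
        (by simpa [T] using b2) hd
      have e : |x 0| = |y 0| := by grind
      exact ⟨by linarith, fun _ => Lex.snd _ e q2⟩
    · have : |x 0| + 1 < |y 0| := by grind
      have h1 : |(1 : ℤ)| = 1 := by simp
      exact ⟨by linarith, fun _ => Lex.head _ (by linarith)⟩
  · by_cases hx : x 0 = -h
    · obtain ⟨b1, b2⟩ := g.p2 0 hx
      obtain ⟨q1, q2⟩ := hQ (T x) (T y) (-1) (Or.inr rfl) g.shift
        (by simp [T] at *; linarith) (by simp [T] at *; linarith) hd
      have e : |x 0| = |y 0| := by grind
      exact ⟨by linarith, fun _ => Lex.snd _ e q2⟩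
    · have : |x 0| + 1 < |y 0| := by grind
      have h1 : |(-1 : ℤ)| = 1 := by simp
      exact ⟨by linarith, fun _ => Lex.head _ (by linarith)⟩
  · generalize 2 * h * d = P at *
    have : |x 0| + |d| ≤ |y 0| := by grind
    have : 1 ≤ |d| := by grind
    exact ⟨by linarith, fun _ => Lex.head _ (by linarith)⟩
  · generalize 2 * h * d = P at *
    have : |x 0| + |d| ≤ |y 0| := by grind
    have : 1 ≤ |d| := by grind
    exact ⟨by linarith, fun _ => Lex.head _ (by linarith)⟩

lemma main {h : ℤ} (hh : 1 ≤ h) (N : ℕ) : A h N ∧ Q h N := by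
  induction N with
  | zero =>
    refine ⟨fun x y _ _ => ⟨by simp [L], fun _ => Or.inl (by simp)⟩, ?_⟩
    intro x y δ hδ _ _ _ hs
    simp [S] at hs
    omega
  | succ N ih => exact ⟨Astep hh ih.1 ih.2, Qstep hh ih.1⟩

lemma eta_eq (u w : ℕ) (x : ℕ →₀ ℤ) :
    (etaLen u w x : ℤ) = l1D x + u + w + 2 * max 0 ((kIdx x : ℤ) - max u w) := by
  unfold etaLen
  split_ifs <;> omega

lemma zero_of_lt {x : ℕ →₀ ℤ} {i : ℕ} (h : kIdx x < i) : x i = 0 := by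
  by_contra hx
  have : id i ≤ kIdx x := Finset.le_sup (f := id) (Finsupp.mem_support_iff.2 hx)
  simp at this
  omega

lemma kIdx_le {x : ℕ →₀ ℤ} {m : ℕ} (h : ∀ i, m < i → x i = 0) : kIdx x ≤ m := by
  unfold kIdx
  apply Finset.sup_le
  intro i hi
  by_contra hc
  exact (Finsupp.mem_support_iff.1 hi) (h i (by simpa using hc))

lemma supp_sub {x : ℕ →₀ ℤ} {N : ℕ} (h : kIdx x < N) : x.support ⊆ Finset.range N := by
  intro i hi
  rw [Finset.mem_range]
  by_contra hc
  exact (Finsupp.mem_support_iff.1 hi) (zero_of_lt (by omega))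

lemma sigma_eq (n : ℕ) {x : ℕ →₀ ℤ} {N : ℕ} (h : kIdx x < N) : sigmaD n x = S n N x := by
  unfold sigmaD S
  exact Finsupp.sum_of_support_subset _ (supp_sub h) _ (by simp)

lemma l1_eq {x : ℕ →₀ ℤ} {N : ℕ} (h : kIdx x < N) : (l1D x : ℤ) = L N x := by
  unfold l1D L
  rw [Finsupp.sum_of_support_subset _ (supp_sub h) _ (by simp)]
  simp

lemma sigma_add (n : ℕ) (x y : ℕ →₀ ℤ) : sigmaD n (x + y) = sigmaD n x + sigmaD n y := by
  unfold sigmaD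
  exact Finsupp.sum_add_index' (by simp) (by intros; ring)

lemma sigma_single (n i : ℕ) (c : ℤ) : sigmaD n (Finsupp.single i c) = c * n ^ i := by
  unfold sigmaD
  exact Finsupp.sum_single_index (by simp)

/-- changing digits on a finite set of indices -/
lemma L_diff {N : ℕ} {x y : ℕ → ℤ} (s : Finset ℕ) (hs : s ⊆ Finset.range N)
    (h : ∀ i ∉ s, y i = x i) : L N y - L N x = ∑ i ∈ s, (|y i| - |x i|) := by
  unfold L
  rw [← Finset.sum_sub_distrib]
  symm
  apply Finset.sum_subset hs
  intro i _ hi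
  rw [h i hi, sub_self]

lemma good_imp (n u w : ℕ) (h : ℕ) (hh : 1 ≤ h) (hn : n = 2 * h) (x : ℕ →₀ ℤ)
    (g : Good h x) (hk : kIdx x < max u w) : IsMinimalVec n u w x := by
  have key : ∀ y : ℕ →₀ ℤ, sigmaD n y = sigmaD n x →
      (l1D x : ℤ) ≤ l1D y ∧ ((l1D x : ℤ) = l1D y → absLexLE x y) := by
    intro y hy
    set N := max (kIdx x) (kIdx y) + 1 with hN
    have hx1 : kIdx x < N := by omega
    have hy1 : kIdx y < N := by omega
    rw [sigma_eq n hx1, sigma_eq n hy1] at hy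
    rw [l1_eq hx1, l1_eq hy1]
    have hc : (n : ℤ) = 2 * (h : ℤ) := by exact_mod_cast hn
    rw [hc] at hy
    obtain ⟨a1, a2⟩ := (main (h := (h : ℤ)) (by exact_mod_cast hh) N).1 x y g hy
    refine ⟨a1, fun e => ?_⟩
    rcases a2 e with a | a
    · left
      intro i
      by_cases hi : i < N
      · exact a i hi
      · rw [zero_of_lt (x := x) (by omega), zero_of_lt (x := y) (by omega)]
    · exact Or.inr a
  have ex := eta_eq u w x
  refine ⟨fun y hy => ?_, fun _ y hy he => ?_⟩
  · have ey := eta_eq u w y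
    have := (key y hy).1
    omega
  · have ey := eta_eq u w y
    have := (key y hy).1
    exact (key y hy).2 (by omega)

lemma not_min {n u w : ℕ} {x y : ℕ →₀ ℤ} (hk : kIdx x < max u w) (he : Even n)
    (hs : sigmaD n y = sigmaD n x) (hy : kIdx y ≤ max u w)
    (hl : L (max u w + 1) y < L (max u w + 1) x ∨
      (L (max u w + 1) y = L (max u w + 1) x ∧
        ∃ i, (∀ j < i, |y j| = |x j|) ∧ |y i| < |x i|)) :
    ¬ IsMinimalVec n u w x := by
  rintro ⟨m1, m2⟩
  have ex := eta_eq u w x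
  have ey := eta_eq u w y
  have lx := l1_eq (x := x) (N := max u w + 1) (by omega)
  have ly := l1_eq (x := y) (N := max u w + 1) (by omega)
  have := m1 y hs
  rcases hl with hl | ⟨hl, i, h1, h2⟩
  · omega
  · rcases m2 he y hs (by omega) with a | ⟨j, b1, b2⟩
    · have := a i
      omega
    · rcases lt_trichotomy i j with c | c | c
      · have := b1 i c
        omega
      · subst c; omega
      · have := h1 j c
        omega

lemma bad1 {n u w h : ℕ} (hh : 1 ≤ h) (hn : n = 2 * h) {x : ℕ →₀ ℤ} (hk : kIdx x < max u w)
    {i : ℕ} {δ : ℤ} (hi : i < kIdx x) (hδ : δ = 1 ∨ δ = -1) (h0 : x i = δ * h)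
    (h1 : Int.sign (x (i + 1)) = -δ) : ¬ IsMinimalVec n u w x := by
  let y : ℕ →₀ ℤ := x + (Finsupp.single i (-δ * n) + Finsupp.single (i + 1) δ)
  have y0 : y i = x i - δ * n := by simp [y]; ring
  have y1 : y (i + 1) = x (i + 1) + δ := by simp [y]
  have yo : ∀ j ∉ ({i, i + 1} : Finset ℕ), y j = x j := by
    intro j hj
    simp only [Finset.mem_insert, Finset.mem_singleton, not_or] at hj
    simp [y, Finsupp.single_apply, Ne.symm hj.1, Ne.symm hj.2]
  apply not_min (y := y) hk (by rw [hn]; exact even_two_mul h)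
  · simp only [y, sigma_add, sigma_single]; ring
  · apply kIdx_le
    intro j hj
    rw [yo j (by simp; omega)]
    exact zero_of_lt (by omega)
  · left
    have := L_diff (N := max u w + 1) (x := x) (y := y) {i, i + 1}
      (by intro j; simp; omega) yo
    rw [Finset.sum_pair (by omega), y0, y1, h0] at this
    have hn' : (n : ℤ) = 2 * h := by exact_mod_cast hn
    rw [hn'] at this
    rcases hδ with rfl | rfl
    · have := Int.sign_eq_neg_one_iff_neg.1 h1
      grind
    · have := Int.sign_eq_one_iff_pos.1 (by simpa using h1)
      grind

lemma bad2 {n u w h : ℕ} (hh : 1 ≤ h) (hn : n = 2 * h) {x : ℕ →₀ ℤ} (hk : kIdx x < max u w)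
    {i : ℕ} {δ : ℤ} (hi : i < kIdx x) (hδ : δ = 1 ∨ δ = -1) (h0 : x i = δ * h)
    (h1 : x (i + 1) = δ * h) : ¬ IsMinimalVec n u w x := by
  let y : ℕ →₀ ℤ := x + (Finsupp.single i (-δ * n) +
    (Finsupp.single (i + 1) (δ - δ * n) + Finsupp.single (i + 2) δ))
  have y0 : y i = x i - δ * n := by simp [y]; ring
  have y1 : y (i + 1) = x (i + 1) + δ - δ * n := by simp [y]; ring
  have y2 : y (i + 2) = x (i + 2) + δ := by simp [y]
  have yo : ∀ j ∉ ({i, i + 1, i + 2} : Finset ℕ), y j = x j := by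
    intro j hj
    simp only [Finset.mem_insert, Finset.mem_singleton, not_or] at hj
    simp [y, Finsupp.single_apply, Ne.symm hj.1, Ne.symm hj.2.1, Ne.symm hj.2.2]
  have hn' : (n : ℤ) = 2 * h := by exact_mod_cast hn
  have e0 : |y i| = |x i| := by
    rw [y0, h0, hn']; rcases hδ with rfl | rfl <;> grind
  have e1 : |y (i + 1)| = |x (i + 1)| - 1 := by
    rw [y1, h1, hn']; rcases hδ with rfl | rfl <;> grind
  have e2 : |y (i + 2)| ≤ |x (i + 2)| + 1 := by
    rw [y2]; rcases hδ with rfl | rfl <;> grind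
  apply not_min (y := y) hk (by rw [hn]; exact even_two_mul h)
  · simp only [y, sigma_add, sigma_single]; ring
  · apply kIdx_le
    intro j hj
    rw [yo j (by simp; omega)]
    exact zero_of_lt (by omega)
  · have := L_diff (N := max u w + 1) (x := x) (y := y) {i, i + 1, i + 2}
      (by intro j; simp; omega) yo
    rw [Finset.sum_insert (by simp), Finset.sum_pair (by omega)] at this
    rcases lt_or_eq_of_le (show L (max u w + 1) y ≤ L (max u w + 1) x by linarith) with q | q
    · exact Or.inl q
    · refine Or.inr ⟨q, i + 1, ?_, by linarith⟩
      intro j hj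
      by_cases hj' : j = i
      · rw [hj', e0]
      · rw [yo j (by simp; omega)]

end EAD

/-- For even `n` and `x ∈ B_v^{u,w}` with `k_x < max(u,w)`: `x` fails to be minimal iff
it contains adjacent digits `(δ·n/2, δ·n/2)`, or a digit `δ·n/2` followed by a digit of
sign `-δ`, for some `δ ∈ {±1}`. -/
theorem even_adjacent_digits (n : ℕ) (hn : 2 ≤ n) (heven : Even n) (u w : ℕ) (v : ℤ)
    (hv : v ≠ 0) (x : ℕ →₀ ℤ) (hx : x ∈ BoxSet n u w v) (hk : kIdx x < max u w) :
    ¬ IsMinimalVec n u w x ↔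
      ∃ (i : ℕ) (δ : ℤ), i < kIdx x ∧ (δ = 1 ∨ δ = -1) ∧
        ((x i = δ * ((n / 2 : ℕ) : ℤ) ∧ x (i + 1) = δ * ((n / 2 : ℕ) : ℤ)) ∨
         (x i = δ * ((n / 2 : ℕ) : ℤ) ∧ Int.sign (x (i + 1)) = -δ)) := by
  obtain ⟨hs, hb1, hb2, -⟩ := hx
  obtain ⟨h, hn2⟩ := heven
  have hn' : n = 2 * h := by omega
  have hh : 1 ≤ h := by omega
  have hdiv : n / 2 = h := by omega
  rw [hdiv]
  rw [hdiv] at hb1 hb2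
  constructor
  · intro hm
    by_contra hc
    apply hm
    push Not at hc
    have tail : ∀ i (δ : ℤ), (δ = 1 ∨ δ = -1) → x i = δ * h →
        x (i + 1) ≠ δ * h ∧ Int.sign (x (i + 1)) ≠ -δ := by
      intro i δ hδ hi
      by_cases hik : i < kIdx x
      · have := hc i δ hik hδ
        exact ⟨this.1 hi, this.2 hi⟩
      · rw [EAD.zero_of_lt (x := x) (i := i + 1) (by omega)]
        rcases hδ with rfl | rfl
        · constructor
          · omega
          · simp
        · constructor
          · omega
          · simp
    have bd : ∀ i, |x i| ≤ (h : ℤ) := by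
      intro i
      rcases lt_trichotomy i (kIdx x) with c | c | c
      · exact hb1 i c
      · rw [c]; exact hb2 hk
      · rw [EAD.zero_of_lt c]; simp
    refine EAD.good_imp n u w h hh hn' x ⟨bd, ?_, ?_⟩ hk
    · intro i hi
      have := tail i 1 (Or.inl rfl) (by rw [hi]; ring)
      have b := abs_le.1 (bd (i + 1))
      rw [ne_eq, ne_eq, Int.sign_eq_neg_one_iff_neg] at this
      omega
    · intro i hi
      have := tail i (-1) (Or.inr rfl) (by rw [hi]; ring)
      have b := abs_le.1 (bd (i + 1))
      rw [ne_eq, ne_eq, neg_neg, Int.sign_eq_one_iff_pos] at this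
      omega
  · rintro ⟨i, δ, hi, hδ, ⟨h0, h1⟩ | ⟨h0, h1⟩⟩
    · exact EAD.bad2 hh hn' hk hi hδ h0 h1
    · exact EAD.bad1 hh hn' hk hi hδ h0 h1
end

section
/- For every integer n ≥ 2, the language D_n is a regular language over the finite alphabet Γ = {m ∈ ℤ : |m| ≤ ⌊n/2⌋}, where D_n is the set of finite words (x_0, …, x_k) over Γ with x_k ≠ 0 such that there exist integers u, w ≥ 0 with k < w for which the digit vector x (with entries x_0, …, x_k and 0 beyond index k) is a minimal vector of B_v^{u,w}, where v = Σ_{i=0}^{k} x_i nⁱ. -/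
/-- The digit vector whose first entries are given by the list `l` (and `0` beyond). -/
noncomputable def ofList (l : List ℤ) : ℕ →₀ ℤ :=
  ∑ i ∈ Finset.range l.length, Finsupp.single i (l.getD i 0)

/-- The language `D_n` over the alphabet `{m : ℤ | |m| ≤ ⌊n/2⌋}`: words `(x_0, …, x_k)`
with `x_k ≠ 0` whose digit vector is a minimal vector of `B_v^{u,w}` for some `u, w` with
`k < w`, where `v = ∑ x_i nⁱ`. -/
def DnLang (n : ℕ) : Set (List {m : ℤ // |m| ≤ ((n / 2 : ℕ) : ℤ)}) :=
  {l | ∃ h : l ≠ [], (l.getLast h : ℤ) ≠ 0 ∧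
    ∃ u w : ℕ, kIdx (ofList (l.map Subtype.val)) < w ∧
      ofList (l.map Subtype.val) ∈
        BoxSet n u w (sigmaD n (ofList (l.map Subtype.val))) ∧
      IsMinimalVec n u w (ofList (l.map Subtype.val))}


namespace DnAux

noncomputable def consD (a : ℤ) (y : ℕ →₀ ℤ) : ℕ →₀ ℤ :=
  Finsupp.single 0 a + y.mapDomain Nat.succ

lemma consD_zero (a : ℤ) (y : ℕ →₀ ℤ) : consD a y 0 = a := by
  simp only [consD, Finsupp.add_apply, Finsupp.single_eq_same]
  rw [Finsupp.mapDomain_of_notMem_range]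
  · simp
  · simp

lemma consD_succ (a : ℤ) (y : ℕ →₀ ℤ) (j : ℕ) : consD a y (j + 1) = y j := by
  simp only [consD, Finsupp.add_apply]
  have := Finsupp.mapDomain_apply (f := Nat.succ) Nat.succ_injective y j
  rw [Nat.succ_eq_add_one] at this
  rw [this]
  simp

lemma exists_consD (y : ℕ →₀ ℤ) : ∃ a z, y = consD a z := by
  refine ⟨y 0, y.comapDomain Nat.succ (Nat.succ_injective.injOn), ?_⟩
  ext j
  cases j with
  | zero => rw [consD_zero]
  | succ j => rw [consD_succ]; simp

lemma le_kIdx {y : ℕ →₀ ℤ} {j : ℕ} (h : y j ≠ 0) : j ≤ kIdx y :=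
  Finset.le_sup (f := id) (Finsupp.mem_support_iff.2 h)

lemma kIdx_le {y : ℕ →₀ ℤ} {m : ℕ} (h : ∀ j, y j ≠ 0 → j ≤ m) : kIdx y ≤ m :=
  Finset.sup_le fun j hj => h j (Finsupp.mem_support_iff.1 hj)

lemma kIdx_le_iff {y : ℕ →₀ ℤ} {m : ℕ} : kIdx y ≤ m ↔ ∀ j, y j ≠ 0 → j ≤ m :=
  ⟨fun h _ hj => (le_kIdx hj).trans h, kIdx_le⟩

lemma sigma_eq (n : ℕ) (y : ℕ →₀ ℤ) (N : ℕ) (h : kIdx y < N) :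
    sigmaD n y = ∑ i ∈ Finset.range N, y i * (n : ℤ) ^ i := by
  apply Finsupp.sum_of_support_subset
  · intro i hi
    have := le_kIdx (Finsupp.mem_support_iff.1 hi)
    simp; omega
  · simp

lemma l1_eq (y : ℕ →₀ ℤ) (N : ℕ) (h : kIdx y < N) :
    l1D y = ∑ i ∈ Finset.range N, (y i).natAbs := by
  apply Finsupp.sum_of_support_subset
  · intro i hi
    have := le_kIdx (Finsupp.mem_support_iff.1 hi)
    simp; omega
  · simp

lemma kIdx_consD_le (a : ℤ) (y : ℕ →₀ ℤ) : kIdx (consD a y) ≤ kIdx y + 1 := by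
  apply kIdx_le
  intro j hj
  cases j with
  | zero => omega
  | succ j => rw [consD_succ] at hj; have := le_kIdx hj; omega

lemma kIdx_consD_sub (a : ℤ) (y : ℕ →₀ ℤ) (m : ℕ) :
    kIdx (consD a y) - (m + 1) = kIdx y - m := by
  apply le_antisymm
  · have := kIdx_consD_le a y; omega
  · have : kIdx y ≤ kIdx (consD a y) - 1 := by
      apply kIdx_le
      intro j hj
      have := le_kIdx (y := consD a y) (j := j + 1) (by rwa [consD_succ])
      omega
    omega

lemma sigma_consD (n : ℕ) (a : ℤ) (y : ℕ →₀ ℤ) :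
    sigmaD n (consD a y) = a + n * sigmaD n y := by
  rw [sigma_eq n (consD a y) (kIdx y + 2) (by have := kIdx_consD_le a y; omega),
    sigma_eq n y (kIdx y + 1) (by omega), Finset.sum_range_succ', Finset.mul_sum]
  simp only [consD_succ, consD_zero]
  rw [add_comm]
  congr 1
  · simp
  · apply Finset.sum_congr rfl
    intros; ring

lemma l1_consD (a : ℤ) (y : ℕ →₀ ℤ) : l1D (consD a y) = a.natAbs + l1D y := by
  rw [l1_eq (consD a y) (kIdx y + 2) (by have := kIdx_consD_le a y; omega),
    l1_eq y (kIdx y + 1) (by omega), Finset.sum_range_succ']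
  simp only [consD_succ, consD_zero]
  rw [add_comm]

noncomputable def app (p : List ℤ) (y : ℕ →₀ ℤ) : ℕ →₀ ℤ := p.foldr consD y

lemma ofList_nil : ofList [] = 0 := by simp [ofList]

lemma ofList_apply (l : List ℤ) (j : ℕ) : ofList l j = l.getD j 0 := by
  simp only [ofList, Finsupp.finsetSum_apply, Finsupp.single_apply]
  rw [Finset.sum_ite_eq' (Finset.range l.length) j]
  split_ifs with h
  · rfl
  · rw [List.getD_eq_default]; simpa using h

lemma ofList_cons (a : ℤ) (l : List ℤ) : ofList (a :: l) = consD a (ofList l) := by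
  ext j
  cases j with
  | zero => rw [consD_zero, ofList_apply]; simp
  | succ j => rw [consD_succ, ofList_apply, ofList_apply]; simp

lemma ofList_append (p s : List ℤ) : ofList (p ++ s) = app p (ofList s) := by
  induction p with
  | nil => rfl
  | cons a p ih => rw [List.cons_append, ofList_cons, ih]; rfl

def S (n : ℕ) : List ℤ → ℤ
  | [] => 0
  | a :: p => a + n * S n p

def L : List ℤ → ℕ
  | [] => 0
  | a :: p => a.natAbs + L p

def EQ : List ℤ → List ℤ → Prop
  | [], [] => True
  | a :: p, b :: q => |a| = |b| ∧ EQ p q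
  | _, _ => False

def LL : List ℤ → List ℤ → Prop
  | a :: p, b :: q => |b| < |a| ∨ (|a| = |b| ∧ LL p q)
  | _, _ => False

def lexlt (x y : ℕ →₀ ℤ) : Prop := ∃ i : ℕ, (∀ j < i, |x j| = |y j|) ∧ |y i| < |x i|

noncomputable def cost (m : ℕ) (y : ℕ →₀ ℤ) : ℕ := l1D y + 2 * (kIdx y - m)

lemma not_absLexLE (x y : ℕ →₀ ℤ) : ¬ absLexLE x y ↔ lexlt x y := by
  constructor
  · intro h
    unfold absLexLE at h
    push Not at h
    obtain ⟨h1, h2⟩ := h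
    classical
    refine ⟨Nat.find h1, ?_, ?_⟩
    · intro j hj
      have := Nat.find_min h1 hj
      simpa using this
    · have h3 := h2 (Nat.find h1) (by
        intro j hj
        have := Nat.find_min h1 hj
        simpa using this)
      exact lt_of_le_of_ne h3 (Ne.symm (Nat.find_spec h1))
  · rintro ⟨i, h1, h2⟩ (h | ⟨k, h3, h4⟩)
    · rw [h i] at h2; exact lt_irrefl _ h2
    · rcases lt_trichotomy i k with h | h | h
      · have := h3 i h; omega
      · subst h; omega
      · have := h1 k h; omega

lemma lexlt_cons (a b : ℤ) (x y : ℕ →₀ ℤ) :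
    lexlt (consD a x) (consD b y) ↔ |b| < |a| ∨ (|a| = |b| ∧ lexlt x y) := by
  constructor
  · rintro ⟨i, h1, h2⟩
    cases i with
    | zero => left; simpa [consD_zero] using h2
    | succ i =>
      right
      refine ⟨by simpa [consD_zero] using h1 0 (by omega), i, ?_, ?_⟩
      · intro j hj
        simpa [consD_succ] using h1 (j + 1) (by omega)
      · simpa [consD_succ] using h2
  · rintro (h | ⟨h, i, h1, h2⟩)
    · exact ⟨0, by simp, by simpa [consD_zero] using h⟩
    · refine ⟨i + 1, ?_, by simpa [consD_succ] using h2⟩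
      intro j hj
      cases j with
      | zero => simpa [consD_zero] using h
      | succ j => simpa [consD_succ] using h1 j (by omega)

lemma lexlt_app (p q : List ℤ) (hpq : q.length = p.length) (x y : ℕ →₀ ℤ) :
    lexlt (app p x) (app q y) ↔ LL p q ∨ (EQ p q ∧ lexlt x y) := by
  induction p generalizing q with
  | nil =>
    have : q = [] := by simpa using hpq
    subst this
    simp [app, LL, EQ]
  | cons a p ih =>
    cases q with
    | nil => simp at hpq
    | cons b q =>
      have := ih q (by simpa using hpq)
      change lexlt (consD a (app p x)) (consD b (app q y)) ↔ _
      rw [lexlt_cons, this]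
      simp only [LL, EQ]
      tauto

lemma sigma_app (n : ℕ) (p : List ℤ) (y : ℕ →₀ ℤ) :
    sigmaD n (app p y) = S n p + (n : ℤ) ^ p.length * sigmaD n y := by
  induction p with
  | nil => simp [app, S]
  | cons a p ih =>
    change sigmaD n (consD a (app p y)) = _
    rw [sigma_consD, ih]
    simp only [S, List.length_cons]
    ring

lemma l1_app (p : List ℤ) (y : ℕ →₀ ℤ) : l1D (app p y) = L p + l1D y := by
  induction p with
  | nil => simp [app, L]
  | cons a p ih =>
    change l1D (consD a (app p y)) = _
    rw [l1_consD, ih]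
    simp only [L]
    ring

lemma kIdx_app (p : List ℤ) (y : ℕ →₀ ℤ) (m : ℕ) :
    kIdx (app p y) - (p.length + m) = kIdx y - m := by
  induction p with
  | nil => simp [app]
  | cons a p ih =>
    change kIdx (consD a (app p y)) - _ = _
    have h := kIdx_consD_sub a (app p y) (p.length + m)
    simp only [List.length_cons]
    omega

lemma cost_app (p : List ℤ) (y : ℕ →₀ ℤ) (m : ℕ) :
    cost (p.length + m) (app p y) = L p + cost m y := by
  simp only [cost, kIdx_app, l1_app]; ring

lemma exists_app (i : ℕ) (y : ℕ →₀ ℤ) : ∃ p z, p.length = i ∧ y = app p z := by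
  induction i generalizing y with
  | zero => exact ⟨[], y, rfl, rfl⟩
  | succ i ih =>
    obtain ⟨a, z, rfl⟩ := exists_consD y
    obtain ⟨p, z, h, rfl⟩ := ih z
    exact ⟨a :: p, z, by simp [h], rfl⟩

lemma app_digit (p : List ℤ) (y : ℕ →₀ ℤ) (b : ℤ) (hb : b ∈ p) :
    ∃ j < p.length, app p y j = b := by
  induction p with
  | nil => simp at hb
  | cons a p ih =>
    rcases List.mem_cons.1 hb with rfl | h
    · exact ⟨0, by simp, consD_zero _ _⟩
    · obtain ⟨j, hj, h⟩ := ih h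
      exact ⟨j + 1, by simpa using hj, by rw [← h]; exact consD_succ _ _ _⟩

lemma S_bound (n : ℕ) (p : List ℤ) (h : ∀ b ∈ p, |b| ≤ (n : ℤ) - 1) :
    |S n p| ≤ (n : ℤ) ^ p.length - 1 := by
  induction p with
  | nil => simp [S]
  | cons a p ih =>
    have h1 := ih (fun b hb => h b (by simp [hb]))
    have h2 := h a (by simp)
    simp only [S, List.length_cons]
    have h3 : |a + n * S n p| ≤ |a| + n * |S n p| := by
      refine (abs_add_le _ _).trans ?_
      rw [abs_mul, Nat.abs_cast]
    have h4 : (n : ℤ) * |S n p| ≤ n * ((n : ℤ) ^ p.length - 1) :=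
      mul_le_mul_of_nonneg_left h1 (by positivity)
    rw [pow_succ]
    linarith

lemma l1_add_single (y : ℕ →₀ ℤ) (j : ℕ) (a : ℤ) :
    l1D (y + Finsupp.single j a) + (y j).natAbs = l1D y + (y j + a).natAbs := by
  set N := kIdx y + kIdx (y + Finsupp.single j a) + j + 1
  rw [l1_eq _ N (by omega), l1_eq y N (by omega)]
  have hj : j ∈ Finset.range N := by simp [N]
  rw [← Finset.add_sum_erase _ _ hj, ← Finset.add_sum_erase (Finset.range N) _ hj]
  have : ∑ x ∈ (Finset.range N).erase j, ((y + Finsupp.single j a) x).natAbs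
      = ∑ x ∈ (Finset.range N).erase j, (y x).natAbs := by
    apply Finset.sum_congr rfl
    intro x hx
    have : x ≠ j := (Finset.mem_erase.1 hx).1
    simp [Finsupp.single_apply, this.symm]
  rw [this]
  simp
  omega

lemma kIdx_add_single (y : ℕ →₀ ℤ) (j : ℕ) (a : ℤ) :
    kIdx (y + Finsupp.single j a) ≤ max (kIdx y) j := by
  apply kIdx_le
  intro i hi
  by_cases h : i = j
  · omega
  · have : y i ≠ 0 := by
      simpa [Finsupp.single_apply, Ne.symm h] using hi
    have := le_kIdx this
    omega

lemma sigma_add_single (n : ℕ) (y : ℕ →₀ ℤ) (j : ℕ) (a : ℤ) :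
    sigmaD n (y + Finsupp.single j a) = sigmaD n y + a * (n : ℤ) ^ j := by
  unfold sigmaD
  rw [Finsupp.sum_add_index']
  · simp
  · simp
  · intros; ring

lemma cost_add_single (y : ℕ →₀ ℤ) (j m : ℕ) (a : ℤ) (h : j ≤ m) :
    cost m (y + Finsupp.single j a) + (y j).natAbs ≤ cost m y + (y j + a).natAbs := by
  have := l1_add_single y j a
  have := kIdx_add_single y j a
  unfold cost
  omega

def bad (n m : ℕ) (x y : ℕ →₀ ℤ) : Prop :=
  sigmaD n y = sigmaD n x ∧
    (cost m y < l1D x ∨ (Even n ∧ cost m y = l1D x ∧ lexlt x y))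

lemma bad_of_lt {n m : ℕ} {x y y' : ℕ →₀ ℤ} (h : bad n m x y)
    (hs : sigmaD n y' = sigmaD n y) (hc : cost m y' < cost m y) : bad n m x y' := by
  obtain ⟨h1, h2⟩ := h
  refine ⟨hs.trans h1, Or.inl ?_⟩
  omega

lemma exists_min_bad {n m : ℕ} {x : ℕ →₀ ℤ} (h : ∃ y, bad n m x y) :
    ∃ y, bad n m x y ∧ ∀ y', sigmaD n y' = sigmaD n y → cost m y ≤ cost m y' := by
  classical
  have h' : ∃ N y, bad n m x y ∧ cost m y = N := by
    obtain ⟨y, hy⟩ := h; exact ⟨_, y, hy, rfl⟩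
  obtain ⟨y, hy, hc⟩ := Nat.find_spec h'
  refine ⟨y, hy, fun y' hs => ?_⟩
  by_contra hlt
  push Not at hlt
  exact Nat.find_min h' (m := cost m y') (by omega) ⟨y', bad_of_lt hy hs hlt, rfl⟩

lemma min_digit {n m : ℕ} (hn : 2 ≤ n) {y : ℕ →₀ ℤ}
    (hy : ∀ y', sigmaD n y' = sigmaD n y → cost m y ≤ cost m y') (j : ℕ) (hj : j + 1 ≤ m) :
    |y j| ≤ (n : ℤ) - 1 := by
  have key : ∀ e : ℤ, cost m y ≤ cost m (y + Finsupp.single j (-(n * e)) + Finsupp.single (j + 1) e) := by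
    intro e
    apply hy
    rw [sigma_add_single, sigma_add_single]
    ring
  have b1 : ∀ e : ℤ, _ := fun e => cost_add_single y j m (-(n * e)) (by omega)
  have b2 : ∀ e : ℤ, _ := fun e =>
    cost_add_single (y + Finsupp.single j (-(n * e))) (j + 1) m e hj
  have k1 := key 1
  have k2 := key (-1)
  have c1 := b1 1
  have c2 := b1 (-1)
  have d1 := b2 1
  have d2 := b2 (-1)
  rw [abs_le]
  constructor <;> by_contra hcon <;> push Not at hcon <;> omega

/-- prefix-detected badness -/
def eP (n : ℕ) (p : List ℤ) : Prop :=
  ∃ q : List ℤ, ∃ c : ℤ, q.length = p.length ∧ S n q + c * (n : ℤ) ^ p.length = S n p ∧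
    L q + c.natAbs < L p

def tP (n : ℕ) (p : List ℤ) (c d : ℤ) (E G : Prop) : Prop :=
  ∃ q : List ℤ, q.length = p.length ∧ S n q + c * (n : ℤ) ^ p.length = S n p ∧
    (L q : ℤ) = L p + d ∧ (EQ p q ↔ E) ∧ (LL p q ↔ G)

def sufBad (n : ℕ) (s : List ℤ) (c d : ℤ) (E G : Prop) : Prop :=
  ∃ z : ℕ →₀ ℤ, sigmaD n z = sigmaD n (ofList s) + c ∧
    ((cost s.length z : ℤ) + d < l1D (ofList s) ∨
      (Even n ∧ (cost s.length z : ℤ) + d = l1D (ofList s) ∧ (G ∨ (E ∧ lexlt (ofList s) z))))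

lemma kIdx_ofList_le (l : List ℤ) : kIdx (ofList l) ≤ l.length - 1 := by
  apply kIdx_le
  intro j hj
  rw [ofList_apply] at hj
  by_contra h
  exact hj (List.getD_eq_default _ _ (by omega))

lemma bad_iff {n : ℕ} (hn : 2 ≤ n) (p s : List ℤ) (hs : s ≠ [])
    (hp : ∀ b ∈ p, |b| ≤ (n : ℤ) - 1) :
    (∃ y, bad n (p ++ s).length (ofList (p ++ s)) y) ↔
      eP n p ∨ ∃ c d : ℤ, ∃ E G : Bool, c ∈ Finset.Icc (-1 : ℤ) 1 ∧ d ∈ Finset.Icc (-1 : ℤ) 1 ∧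
        tP n p c d (E = true) (G = true) ∧ sufBad n s c d (E = true) (G = true) := by
  have hs' : 1 ≤ s.length := List.length_pos_iff.2 hs
  rw [List.length_append, ofList_append]
  constructor
  · intro h
    by_cases he : eP n p
    · exact Or.inl he
    right
    obtain ⟨y, hy, hmin⟩ := exists_min_bad h
    obtain ⟨q, z, hq, rfl⟩ := exists_app p.length y
    have hqb : ∀ b ∈ q, |b| ≤ (n : ℤ) - 1 := by
      intro b hb
      obtain ⟨j, hj, rfl⟩ := app_digit q z b hb
      exact min_digit hn hmin j (by omega)
    have h1 := S_bound n q hqb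
    have h2 := S_bound n p hp
    rw [hq] at h1
    obtain ⟨hsig, hbad⟩ := hy
    have hpos : (0 : ℤ) < (n : ℤ) ^ p.length := by positivity
    set c : ℤ := sigmaD n z - sigmaD n (ofList s) with hc
    have hS : S n q + c * (n : ℤ) ^ p.length = S n p := by
      have := hsig
      rw [sigma_app, sigma_app, hq] at this
      rw [hc]; linarith
    have hc1 : c ∈ Finset.Icc (-1 : ℤ) 1 := by
      rw [abs_le] at h1 h2
      rw [Finset.mem_Icc]
      constructor
      · by_contra hcon
        have : c ≤ -2 := by omega
        nlinarith
      · by_contra hcon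
        have : 2 ≤ c := by omega
        nlinarith
    have hup : L q ≤ L p + c.natAbs := by
      have m1 := hmin (app p (z + Finsupp.single 0 (-c))) (by
        rw [sigma_app, sigma_app, sigma_add_single, hq]
        rw [← hS]; ring)
      have m2 := cost_add_single z 0 s.length (-c) (by omega)
      rw [cost_app] at m1
      rw [← hq, cost_app] at m1
      omega
    have hlow : L p ≤ L q + c.natAbs := by
      by_contra hcon
      exact he ⟨q, c, hq, hS, by omega⟩
    rw [Finset.mem_Icc] at hc1
    classical
    refine ⟨c, (L q : ℤ) - L p, decide (EQ p q), decide (LL p q), Finset.mem_Icc.2 hc1, ?_, ?_, ?_⟩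
    · rw [Finset.mem_Icc]; omega
    · exact ⟨q, hq, hS, by ring, by simp, by simp⟩
    · refine ⟨z, by rw [hc]; ring, ?_⟩
      rw [← hq, cost_app, l1_app, lexlt_app _ _ hq] at hbad
      simp only [decide_eq_true_eq]
      rcases hbad with h | ⟨h, h', h''⟩
      · left; omega
      · right; exact ⟨h, by omega, h''⟩
  · rintro (⟨q, c, hq, hS, hL⟩ | ⟨c, d, E, G, -, -, ⟨q, hq, hS, hL, hE, hG⟩, z, hz, hbad⟩)
    · refine ⟨app q (ofList s + Finsupp.single 0 c), ?_, Or.inl ?_⟩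
      · rw [sigma_app, sigma_app, sigma_add_single, hq, ← hS]; ring
      · rw [← hq, cost_app, l1_app]
        have := cost_add_single (ofList s) 0 s.length c (by omega)
        have h3 : cost s.length (ofList s) = l1D (ofList s) := by
          have := kIdx_ofList_le s
          unfold cost; omega
        omega
    · refine ⟨app q z, ?_, ?_⟩
      · rw [sigma_app, sigma_app, hz, hq, ← hS]; ring
      · rw [← hq, cost_app, l1_app, lexlt_app _ _ hq, hE, hG]
        rcases hbad with h | ⟨h, h', h''⟩
        · left; omega
        · right; exact ⟨h, by omega, h''⟩

lemma etaLen_eq (u w : ℕ) (y : ℕ →₀ ℤ) : etaLen u w y = u + w + cost (max u w) y := by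
  unfold etaLen cost
  split_ifs <;> omega

lemma mem_iff (n : ℕ) (l : List {m : ℤ // |m| ≤ ((n / 2 : ℕ) : ℤ)}) :
    l ∈ DnLang n ↔ ∃ h : l ≠ [], (l.getLast h : ℤ) ≠ 0 ∧
      ¬ ∃ y, bad n (l.map Subtype.val).length (ofList (l.map Subtype.val)) y := by
  unfold DnLang
  rw [Set.mem_ofPred_eq]
  refine exists_congr fun h => and_congr_right fun hlast => ?_
  set x := ofList (l.map Subtype.val) with hx
  set m := (l.map Subtype.val).length with hm
  have hm' : m = l.length := by simp [hm]
  have hpos : 0 < l.length := List.length_pos_iff.2 h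
  have hk1 : kIdx x ≤ m - 1 := kIdx_ofList_le _
  have hk2 : m - 1 ≤ kIdx x := by
    apply le_kIdx
    rw [hx, ofList_apply]
    rw [List.getLast_eq_getElem] at hlast
    rw [List.getD_eq_getElem _ _ (by omega)]
    simpa [hm'] using hlast
  have hcx : ∀ M, m ≤ M → cost M x = l1D x := by
    intro M hM; unfold cost; omega
  constructor
  · rintro ⟨u, w, hw, -, hmin⟩ ⟨y, hy, hb⟩
    obtain ⟨h1, h2⟩ := hmin
    simp only [etaLen_eq, hcx (max u w) (by omega)] at h1 h2
    have h3 := h1 y hy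
    have hle : cost (max u w) y ≤ cost m y := by unfold cost; omega
    rcases hb with hb | ⟨he, hb, hl⟩
    · omega
    · exact (not_absLexLE _ _).2 hl (h2 he y hy (by omega))
  · intro hno
    refine ⟨0, m, by omega, ⟨rfl, ?_, ?_, ?_⟩, ?_, ?_⟩
    · intro i _
      rw [hx, ofList_apply]
      by_cases hi : i < (l.map Subtype.val).length
      · rw [List.getD_eq_getElem _ _ hi, List.getElem_map]
        exact (l[i]'(by simpa using hi)).2
      · rw [List.getD_eq_default _ _ (by omega)]; simp; omega
    · intro _
      generalize kIdx x = i
      rw [hx, ofList_apply]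
      by_cases hi : i < (l.map Subtype.val).length
      · rw [List.getD_eq_getElem _ _ hi, List.getElem_map]
        exact (l[i]'(by simpa using hi)).2
      · rw [List.getD_eq_default _ _ (by omega)]; simp; omega
    · intro hcon; omega
    · intro y hy
      simp only [etaLen_eq, hcx (max 0 m) (by omega)]
      by_contra hcon
      exact hno ⟨y, hy, Or.inl (by simp only [Nat.zero_max] at hcon; omega)⟩
    · intro he y hy hc
      simp only [etaLen_eq, hcx (max 0 m) (by omega)] at hc
      by_contra hcon
      exact hno ⟨y, hy, Or.inr ⟨he, by simp only [Nat.zero_max] at hc; omega,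
        (not_absLexLE _ _).1 hcon⟩⟩

abbrev Idx := (Finset.Icc (-1 : ℤ) 1) × (Finset.Icc (-1 : ℤ) 1) × Bool × Bool

def data (n : ℕ) (p : List {m : ℤ // |m| ≤ ((n / 2 : ℕ) : ℤ)}) : Prop × Prop × (Idx → Prop) :=
  (p ∈ DnLang n, eP n (p.map Subtype.val), fun t =>
    tP n (p.map Subtype.val) t.1 t.2.1 (t.2.2.1 = true) (t.2.2.2 = true))

lemma bad_data {n : ℕ} (hn : 2 ≤ n) (p s : List {m : ℤ // |m| ≤ ((n / 2 : ℕ) : ℤ)}) (hs : s ≠ []) :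
    p ++ s ∈ DnLang n ↔ (s.getLast hs : ℤ) ≠ 0 ∧ ¬ ((data n p).2.1 ∨ ∃ t : Idx, (data n p).2.2 t ∧
      sufBad n (s.map Subtype.val) t.1 t.2.1 (t.2.2.1 = true) (t.2.2.2 = true)) := by
  rw [mem_iff, List.map_append, bad_iff hn]
  · have h0 : p ++ s ≠ [] := by simp [hs]
    have h1 : (p ++ s).getLast h0 = s.getLast hs := List.getLast_append_of_ne_nil _ hs
    rw [exists_prop_of_true h0, h1]
    refine and_congr_right fun _ => not_congr (or_congr Iff.rfl ?_)
    constructor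
    · rintro ⟨c, d, E, G, hc, hd, h1, h2⟩
      exact ⟨⟨⟨c, hc⟩, ⟨d, hd⟩, E, G⟩, h1, h2⟩
    · rintro ⟨⟨⟨c, hc⟩, ⟨d, hd⟩, E, G⟩, h1, h2⟩
      exact ⟨c, d, E, G, hc, hd, h1, h2⟩
  · exact fun h => hs (List.map_eq_nil_iff.1 h)
  · intro b hb
    obtain ⟨a, -, rfl⟩ := List.mem_map.1 hb
    have := a.2
    omega

end DnAux

open DnAux in
/-- For every `n ≥ 2` the language `D_n` is regular: it is accepted by a deterministic
finite automaton with finitely many states. -/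
theorem Dn_regular (n : ℕ) (hn : 2 ≤ n) :
    ∃ (S : Type) (_ : Fintype S) (M : DFA {m : ℤ // |m| ≤ ((n / 2 : ℕ) : ℤ)} S),
      M.accepts = DnLang n := by
  have key : Language.IsRegular (DnLang n : Language {m : ℤ // |m| ≤ ((n / 2 : ℕ) : ℤ)}) := by
    apply Language.IsRegular.of_finite_range_leftQuotient
    have hf : Function.FactorsThrough
        (Language.leftQuotient (DnLang n : Language {m : ℤ // |m| ≤ ((n / 2 : ℕ) : ℤ)}))
        (data n) := by
      intro p q hpq
      ext s
      change p ++ s ∈ DnLang n ↔ q ++ s ∈ DnLang n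
      by_cases hs : s = []
      · subst hs
        have := congrArg Prod.fst hpq
        simpa [data] using this
      · rw [bad_data hn p s hs, bad_data hn q s hs, hpq]
    obtain ⟨g, hg⟩ := (Function.factorsThrough_iff _).1 hf
    rw [hg]
    exact (Set.toFinite (Set.range g)).subset (Set.range_comp_subset_range _ _)
  exact key
end

section
/- For every integer n ≥ 2, the language O_n of minimal strict shape 1 geodesics of BS(1,n) is a regular language over the four-letter alphabet {a, a⁻¹, t, t⁻¹}. -/
def tWord (m : ℤ) : List Letter := List.replicate m.natAbs (1, decide (0 < m))

def aWord (m : ℤ) : List Letter := List.replicate m.natAbs (0, decide (0 < m))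

def eta1Word (u w : ℕ) (x : ℕ →₀ ℤ) : List Letter :=
  tWord (-(u : ℤ)) ++ aWord (x 0) ++
    (((List.range (kIdx x)).map fun j => tWord 1 ++ aWord (x (j + 1))).flatten) ++
    tWord ((w : ℤ) - kIdx x)

def OnLang (n : ℕ) : Set (List Letter) :=
  {wd | ∃ (u w : ℕ) (x : ℕ →₀ ℤ), x ≠ 0 ∧
    x ∈ BoxSet n u w (sigmaD n x) ∧ IsMinimalVec n u w x ∧ kIdx x < w ∧
    wd = eta1Word u w x}

namespace OnAux

/-- lexicographic flag update -/
def upd (f : Ordering) (p q : ℤ) : Ordering :=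
  if f = .eq then (if p < q then .lt else if p = q then .eq else .gt) else f

def W (n : ℕ) : List ℤ → ℤ → ℤ → Ordering → Prop
  | [], c, d, f => d + |c| < 0 ∨ (Even n ∧ d + |c| = 0 ∧ f = .lt)
  | a :: s, c, d, f => ∃ c' : ℤ, |c'| ≤ 1 ∧
      W n s c' (d + |a + c - n * c'| - |a|) (upd f |a + c - n * c'| |a|)

def R (n : ℕ) : List ℤ → ℤ → ℤ → Ordering → ℤ × ℤ × Ordering → Prop
  | [], c, d, f, q => q = (c, d, f)
  | a :: s, c, d, f, q => ∃ c' : ℤ, |c'| ≤ 1 ∧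
      R n s c' (d + |a + c - n * c'| - |a|) (upd f |a + c - n * c'| |a|) q

lemma W_append (n : ℕ) (p s : List ℤ) (c d : ℤ) (f : Ordering) :
    W n (p ++ s) c d f ↔ ∃ q, R n p c d f q ∧ W n s q.1 q.2.1 q.2.2 := by
  induction p generalizing c d f with
  | nil => simp [R]
  | cons a p ih =>
    simp only [List.cons_append, W, R, ih]
    constructor
    · rintro ⟨c', h, q, h1, h2⟩; exact ⟨q, ⟨c', h, h1⟩, h2⟩
    · rintro ⟨q, ⟨c', h, h1⟩, h2⟩; exact ⟨c', h, q, h1, h2⟩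

lemma R_bound (n : ℕ) (p : List ℤ) (c d : ℤ) (f : Ordering) (q) (hc : |c| ≤ 1)
    (h : R n p c d f q) : |q.1| ≤ 1 := by
  induction p generalizing c d f with
  | nil => simp only [R] at h; subst h; exact hc
  | cons a p ih =>
    obtain ⟨c', h1, h2⟩ := h
    exact ih _ _ _ h1 h2

lemma R_zero (n : ℕ) (p : List ℤ) : R n p 0 0 .eq (0, 0, .eq) := by
  induction p with
  | nil => simp [R]
  | cons a p ih =>
    refine ⟨0, by simp, ?_⟩
    simpa [upd] using ih

lemma W_mono (n : ℕ) (s : List ℤ) (c d d' : ℤ) (f f' : Ordering) (hd : d' < d)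
    (h : W n s c d f) : W n s c d' f' := by
  induction s generalizing c d d' f f' with
  | nil =>
    simp only [W] at h ⊢
    left
    rcases h with h | ⟨-, h, -⟩ <;> omega
  | cons a s ih =>
    obtain ⟨c', h1, h2⟩ := h
    exact ⟨c', h1, ih _ _ _ _ _ (by omega) h2⟩

lemma W_neg (n : ℕ) (s : List ℤ) (c d : ℤ) (f : Ordering) (hd : d + |c| < 0) :
    W n s c d f := by
  induction s generalizing c d f with
  | nil => exact Or.inl hd
  | cons a s ih =>
    refine ⟨0, by simp, ih _ _ _ ?_⟩
    have := abs_add_le a c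
    simp only [mul_zero, sub_zero, abs_zero]
    omega

lemma W_big (n : ℕ) (s : List ℤ) (c d : ℤ) (f : Ordering) (hc : |c| ≤ 1) (hd : 2 ≤ d)
    (h : W n s c d f) : W n s 0 0 .eq := by
  cases s with
  | nil =>
    exfalso
    have := abs_nonneg c
    rcases h with h | ⟨-, h, -⟩ <;> omega
  | cons a s =>
    obtain ⟨c', h1, h2⟩ := h
    refine ⟨c', h1, W_mono _ _ _ _ _ _ _ ?_ h2⟩
    have h3 : |a + 0 - n * c'| ≤ |a + c - n * c'| + |c| := by
      have := abs_sub (a + c - n * c') c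
      rwa [show a + c - n * c' - c = a + 0 - n * c' by ring] at this
    omega

def G (n : ℕ) : Language ℤ := {xs | (∃ a ∈ xs, a ≠ 0) ∧ ¬ W n xs 0 0 .eq}

def inv (n : ℕ) (p : List ℤ) :
    Prop × Prop × Set (Finset.Icc (-1 : ℤ) 1 × Finset.Icc (-1 : ℤ) 1 × Ordering) :=
  (∃ a ∈ p, a ≠ 0, ∀ s, W n (p ++ s) 0 0 .eq,
    {q | R n p 0 0 .eq (q.1.1, q.2.1.1, q.2.2)})

lemma inv_W (n : ℕ) (p p' s : List ℤ) (h : inv n p = inv n p')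
    (hW : W n (p ++ s) 0 0 .eq) : W n (p' ++ s) 0 0 .eq := by
  simp only [inv, Prod.mk.injEq] at h
  obtain ⟨-, h1, h2⟩ := h
  by_cases hd : ∀ s, W n (p ++ s) 0 0 .eq
  · exact (h1 ▸ hd : ∀ s, W n (p' ++ s) 0 0 .eq) s
  obtain ⟨⟨c, d, f⟩, hR, hq⟩ := (W_append _ _ _ _ _ _).1 hW
  have hc : |c| ≤ 1 := R_bound _ _ _ _ _ _ (by simp) hR
  have hd1 : -1 ≤ d := by
    by_contra hlt
    exact hd fun s => (W_append _ _ _ _ _ _).2 ⟨_, hR, W_neg _ _ _ _ _ (by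
      show d + |c| < 0
      omega)⟩
  rw [W_append]
  by_cases hd2 : 2 ≤ d
  · exact ⟨_, R_zero n p', W_big _ _ _ _ _ hc hd2 hq⟩
  · have hc' := abs_le.1 hc
    have := Set.ext_iff.1 h2 (⟨c, by simp; omega⟩, ⟨d, by simp; omega⟩, f)
    exact ⟨(c, d, f), this.1 hR, hq⟩

lemma G_regular (n : ℕ) : (G n).IsRegular := by
  rw [Language.isRegular_iff_finite_range_leftQuotient]
  have key : ∀ p p', inv n p = inv n p' → (G n).leftQuotient p = (G n).leftQuotient p' := by
    intro p p' h
    have h0 := h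
    simp only [inv, Prod.mk.injEq] at h0
    have h1 := h0.1
    ext s
    show ((∃ a ∈ p ++ s, a ≠ 0) ∧ ¬ W n (p ++ s) 0 0 .eq) ↔
      ((∃ a ∈ p' ++ s, a ≠ 0) ∧ ¬ W n (p' ++ s) 0 0 .eq)
    have h2 : W n (p ++ s) 0 0 .eq ↔ W n (p' ++ s) 0 0 .eq :=
      ⟨inv_W _ _ _ _ h, inv_W _ _ _ _ h.symm⟩
    simp only [List.mem_append, or_and_right, exists_or, h1, h2]
  have hfin : (Set.range (inv n)).Finite := Set.toFinite _
  obtain ⟨g, hg⟩ : ∃ g, (G n).leftQuotient = g ∘ inv n :=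
    (Function.factorsThrough_iff _).1 (fun p p' h => key p p' h)
  rw [hg, Set.range_comp]
  exact hfin.image _

/-! Lists as numbers -/

def val (n : ℕ) : List ℤ → ℤ
  | [] => 0
  | a :: s => a + n * val n s

def l1 : List ℤ → ℤ
  | [] => 0
  | a :: s => |a| + l1 s

lemma l1_nonneg (s : List ℤ) : 0 ≤ l1 s := by
  induction s with
  | nil => simp [l1]
  | cons a s ih => have := abs_nonneg a; simp only [l1]; omega

lemma val_zero (n : ℕ) (s : List ℤ) (h : l1 s = 0) : val n s = 0 := by
  induction s with
  | nil => simp [val]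
  | cons a s ih =>
    have := abs_nonneg a
    have := l1_nonneg s
    simp only [l1] at h
    have ha : a = 0 := abs_eq_zero.1 (by omega)
    simp [val, ha, ih (by omega)]

def Win (n : ℕ) : List ℤ → List ℤ → ℤ → Ordering → Prop
  | [], Y, d, f => d + l1 Y < 0 ∨ (Even n ∧ d + l1 Y = 0 ∧ f = .lt)
  | a :: s, Y, d, f => Win n s Y.tail (d + |Y.headD 0| - |a|) (upd f |Y.headD 0| |a|)

lemma val_hd (n : ℕ) (Y : List ℤ) : val n Y = Y.headD 0 + n * val n Y.tail := by
  cases Y <;> simp [val]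

lemma l1_hd (Y : List ℤ) : l1 Y = |Y.headD 0| + l1 Y.tail := by
  cases Y <;> simp [l1]

lemma Win_iff (n : ℕ) (s Y : List ℤ) (d : ℤ) (f : Ordering) :
    Win n s Y d f ↔ d + l1 Y - l1 s < 0 ∨ (Even n ∧ d + l1 Y - l1 s = 0 ∧
      (f = .lt ∨ f = .eq ∧ ∃ i, (∀ j < i, |Y.getD j 0| = |s.getD j 0|) ∧
        |Y.getD i 0| < |s.getD i 0|)) := by
  induction s generalizing Y d f with
  | nil =>
    have : ¬ ∃ i, (∀ j < i, |Y.getD j 0| = |([] : List ℤ).getD j 0|) ∧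
        |Y.getD i 0| < |([] : List ℤ).getD i 0| := by
      rintro ⟨i, -, h⟩
      rw [List.getD_nil, abs_zero] at h
      exact absurd h (not_lt.2 (abs_nonneg _))
    simp only [Win, l1, this, and_false, or_false, sub_zero]
  | cons a s ih =>
    have hg0 : Y.getD 0 0 = Y.headD 0 := by cases Y <;> simp
    have hg : ∀ i, Y.getD (i + 1) 0 = Y.tail.getD i 0 := by intro i; cases Y <;> simp
    have hex : (∃ i, (∀ j < i, |Y.getD j 0| = |(a :: s).getD j 0|) ∧
        |Y.getD i 0| < |(a :: s).getD i 0|) ↔ (|Y.headD 0| < |a| ∨ |Y.headD 0| = |a| ∧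
        ∃ i, (∀ j < i, |Y.tail.getD j 0| = |s.getD j 0|) ∧
        |Y.tail.getD i 0| < |s.getD i 0|) := by
      constructor
      · rintro ⟨i, h1, h2⟩
        cases i with
        | zero => left; rw [hg0] at h2; simpa using h2
        | succ i =>
          right
          refine ⟨?_, i, ?_, ?_⟩
          · have := h1 0 (by omega); rw [hg0] at this; simpa using this
          · intro j hj
            have := h1 (j + 1) (by omega); rw [hg] at this; simpa using this
          · rw [hg] at h2; simpa using h2
      · rintro (h | ⟨h, i, h1, h2⟩)
        · exact ⟨0, by simp, by rw [hg0]; simpa using h⟩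
        · refine ⟨i + 1, ?_, by rw [hg]; simpa using h2⟩
          intro j hj
          cases j with
          | zero => rw [hg0]; simpa using h
          | succ j => rw [hg]; simpa using h1 j (by omega)
    rw [Win, ih, hex, l1_hd Y, l1]
    have e : d + |Y.headD 0| - |a| + l1 Y.tail - l1 s
      = d + (|Y.headD 0| + l1 Y.tail) - (|a| + l1 s) := by ring
    rw [e]
    refine or_congr Iff.rfl (and_congr Iff.rfl (and_congr Iff.rfl ?_))
    unfold upd
    cases f
    · simp
    · simp only [if_true]
      generalize (∃ i, (∀ j < i, |Y.tail.getD j 0| = |s.getD j 0|) ∧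
        |Y.tail.getD i 0| < |s.getD i 0|) = P
      generalize |Y.headD 0| = p
      split_ifs with h1 h2
      · simp [h1]
      · simp [h2]
      · simp [h1, h2]
    · simp

lemma W_to_list (n : ℕ) (s : List ℤ) (c d : ℤ) (f : Ordering) (h : W n s c d f) :
    ∃ Y : List ℤ, Y.length ≤ s.length + 1 ∧ val n Y = val n s + c ∧ Win n s Y d f := by
  induction s generalizing c d f with
  | nil => exact ⟨[c], by simp, by simp [val], by simpa [Win, W, l1] using h⟩
  | cons a s ih =>
    obtain ⟨c', -, h2⟩ := h
    obtain ⟨Y, h3, h4, h5⟩ := ih _ _ _ h2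
    refine ⟨(a + c - n * c') :: Y, by simpa using h3, ?_, ?_⟩
    · simp only [val, h4]; ring
    · simpa [Win] using h5

lemma Win_mono (n : ℕ) (s Y Y' : List ℤ) (d d' : ℤ) (f f' : Ordering)
    (hY : Y'.tail = Y.tail)
    (hd : d' + |Y'.headD 0| ≤ d + |Y.headD 0|)
    (hf : f = .lt → f' = .lt) (hf' : f = .eq → f' = .lt) (h : Win n s Y d f) :
    Win n s Y' d' f' := by
  rw [Win_iff] at h ⊢
  rw [l1_hd Y] at h
  rw [l1_hd Y', hY]
  rcases h with h | ⟨h1, h2, h3⟩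
  · left; omega
  · have : f' = .lt := by
      rcases h3 with h3 | h3
      · exact hf h3
      · exact hf' h3.1
    rcases lt_or_eq_of_le hd with h4 | h4
    · left; omega
    · right; exact ⟨h1, by omega, Or.inl this⟩

lemma upd_lt {f : Ordering} {p p' q : ℤ} (h : p' < p) :
    upd f p q = .lt → upd f p' q = .lt := by
  unfold upd
  split_ifs <;> first | omega | simp

lemma upd_eq {f : Ordering} {p p' q : ℤ} (h : p' < p) :
    upd f p q = .eq → upd f p' q = .lt := by
  unfold upd
  split_ifs <;> first | omega | simp_all

lemma list_to_W (n : ℕ) (hn : 2 ≤ n) (s : List ℤ) (hs : ∀ a ∈ s, |a| ≤ ((n / 2 : ℕ) : ℤ))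
    (Y : List ℤ) (c d : ℤ) (f : Ordering) (hc : |c| ≤ 1) (hv : val n Y = val n s + c)
    (h : Win n s Y d f) : W n s c d f := by
  induction s generalizing Y c d f with
  | nil =>
    simp only [val, zero_add] at hv
    have h0 := l1_nonneg Y
    have h1 : |c| ≤ l1 Y := by
      by_contra hlt
      have h2 : l1 Y = 0 := by omega
      have h3 := val_zero n Y h2
      rw [← hv, h3] at hlt
      simp at hlt
      omega
    simp only [Win] at h
    simp only [W]
    rcases h with h | ⟨h2, h3, h4⟩
    · left; omega
    · by_cases h5 : d + |c| = 0
      · right; exact ⟨h2, h5, h4⟩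
      · left; omega
  | cons a s ih =>
    have ha := hs a (by simp)
    have hs' : ∀ a ∈ s, |a| ≤ ((n / 2 : ℕ) : ℤ) := fun b hb => hs b (by simp [hb])
    rw [val_hd] at hv
    simp only [val] at hv
    simp only [Win] at h
    set b := Y.headD 0 with hb
    set C := val n Y.tail - val n s with hC
    have hbC : b = a + c - n * C := by rw [hC]; linarith
    have hn2 : (2 : ℤ) ≤ n := by exact_mod_cast hn
    have hac : |a + c| ≤ n := by
      have := abs_add_le a c
      omega
    have hac' := abs_le.1 hac
    by_cases hC1 : |C| ≤ 1
    · refine ⟨C, hC1, ih hs' Y.tail C _ _ hC1 (by omega) ?_⟩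
      rw [← hbC]; exact h
    · obtain ⟨c', hc', h1, h2⟩ : ∃ c' : ℤ, |c'| ≤ 1 ∧ |a + c - n * c'| < |b| ∧
          |a + c - n * c'| + |C - c'| ≤ |b| := by
        rcases le_or_gt 0 C with h0 | h0
        · rw [abs_of_nonneg h0] at hC1
          have e : |b| = n * C - (a + c) := by
            rw [hbC, abs_of_nonpos (by nlinarith)]; ring
          refine ⟨1, by simp, ?_, ?_⟩
          · rw [e, abs_of_nonpos (by linarith)]; nlinarith
          · rw [e, abs_of_nonpos (by linarith), abs_of_nonneg (by omega)]; nlinarith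
        · rw [abs_of_neg h0] at hC1
          have e : |b| = (a + c) - n * C := by
            rw [hbC, abs_of_nonneg (by nlinarith)]
          refine ⟨-1, by simp, ?_, ?_⟩
          · rw [e, abs_of_nonneg (by linarith)]; nlinarith
          · rw [e, abs_of_nonneg (by linarith), abs_of_nonpos (by omega)]; nlinarith
      refine ⟨c', hc', ih hs' ((Y.tail.headD 0 + (c' - C)) :: Y.tail.tail) c' _ _ hc' ?_ ?_⟩
      · have := val_hd n Y.tail
        simp only [val]; omega
      · refine Win_mono n s Y.tail _ _ _ _ _ rfl ?_ ?_ ?_ h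
        · have h3 := abs_add_le (Y.tail.headD 0) (c' - C)
          rw [abs_sub_comm c' C] at h3
          simp only [List.headD_cons]
          omega
        · exact upd_lt h1
        · exact upd_eq h1

/-! Finsupp versus lists -/

lemma sigma_list (n : ℕ) (y : ℕ →₀ ℤ) (Y : List ℤ) (h : ∀ i, y i = Y.getD i 0) :
    sigmaD n y = val n Y := by
  have h1 : sigmaD n y = ∑ i ∈ Finset.range Y.length, y i * (n : ℤ) ^ i := by
    unfold sigmaD
    apply Finsupp.sum_of_support_subset
    · intro i hi
      rw [Finsupp.mem_support_iff, h] at hi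
      by_contra hlt
      simp at hlt
      exact hi (by simp [hlt])
    · simp
  rw [h1]
  simp only [h]
  clear h1 h
  induction Y with
  | nil => simp [val]
  | cons a s ih =>
    rw [List.length_cons, Finset.sum_range_succ', val, ← ih, Finset.mul_sum]
    simp only [List.getD_cons_succ, List.getD_cons_zero, pow_zero, mul_one, pow_succ]
    rw [add_comm]
    congr 1
    exact Finset.sum_congr rfl fun i _ => by ring

lemma l1_list (y : ℕ →₀ ℤ) (Y : List ℤ) (h : ∀ i, y i = Y.getD i 0) :
    (l1D y : ℤ) = l1 Y := by
  have h1 : l1D y = ∑ i ∈ Finset.range Y.length, (y i).natAbs := by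
    unfold l1D
    apply Finsupp.sum_of_support_subset
    · intro i hi
      rw [Finsupp.mem_support_iff, h] at hi
      by_contra hlt
      simp at hlt
      exact hi (by simp [hlt])
    · simp
  rw [h1]
  simp only [h]
  clear h1 h
  push_cast
  induction Y with
  | nil => simp [l1]
  | cons a s ih =>
    rw [List.length_cons, Finset.sum_range_succ', l1, ← ih]
    simp only [List.getD_cons_succ, List.getD_cons_zero]
    rw [add_comm]

lemma kIdx_le (y : ℕ →₀ ℤ) (m : ℕ) : kIdx y ≤ m ↔ ∀ i, m < i → y i = 0 := by
  unfold kIdx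
  rw [Finset.sup_le_iff]
  simp only [Finsupp.mem_support_iff, id]
  constructor
  · intro h i hi
    by_contra h0
    have := h i h0
    omega
  · intro h i hi
    by_contra h0
    exact hi (h i (by omega))

lemma list_of (y : ℕ →₀ ℤ) (N : ℕ) (h : ∀ i, N ≤ i → y i = 0) (i : ℕ) :
    y i = ((List.range N).map y).getD i 0 := by
  by_cases hi : i < N
  · simp [List.getD, hi]
  · have : y i = 0 := h i (by omega)
    simp [List.getD, hi, this]

lemma eta_le (u w : ℕ) (y : ℕ →₀ ℤ) (h : kIdx y ≤ w) : etaLen u w y = u + w + l1D y := by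
  unfold etaLen
  rw [if_pos (Or.inl h)]
  omega

lemma eta_ge (u w : ℕ) (y : ℕ →₀ ℤ) : u + w + l1D y ≤ etaLen u w y := by
  unfold etaLen
  split_ifs with h <;> omega

lemma minimal_iff (n : ℕ) (hn : 2 ≤ n) (u : ℕ) (xs : List ℤ) (x : ℕ →₀ ℤ)
    (hx : ∀ i, x i = xs.getD i 0) (hs : ∀ a ∈ xs, |a| ≤ ((n / 2 : ℕ) : ℤ)) :
    IsMinimalVec n u xs.length x ↔ ¬ W n xs 0 0 .eq := by
  have hkx : kIdx x ≤ xs.length := by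
    rw [kIdx_le]
    intro i hi
    rw [hx]; simp [hi.le]
  have hex := eta_le u _ x hkx
  have hlx := l1_list x xs hx
  have hsx := sigma_list n x xs hx
  constructor
  · rintro ⟨h1, h2⟩ hW
    obtain ⟨Y, hl, hv, hwin⟩ := W_to_list _ _ _ _ _ hW
    obtain ⟨y, hy⟩ : ∃ y : ℕ →₀ ℤ, ∀ i, y i = Y.getD i 0 := ⟨Y.toFinsupp, fun i => by simp⟩
    have hky : kIdx y ≤ xs.length := by
      rw [kIdx_le]
      intro i hi
      rw [hy]; simp [show Y.length ≤ i by omega]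
    have hey := eta_le u _ y hky
    have hly := l1_list y Y hy
    have hsy := sigma_list n y Y hy
    have hss : sigmaD n y = sigmaD n x := by rw [hsy, hsx, hv]; simp
    have h3 := h1 y hss
    rw [Win_iff] at hwin
    rcases hwin with h4 | ⟨h4, h5, h6⟩
    · omega
    · rcases h6 with h6 | ⟨-, i, h6, h7⟩
      · simp at h6
      · simp only [← hx, ← hy] at h6 h7
        rcases h2 h4 y hss (by omega) with h8 | ⟨k, h8, h9⟩
        · have := h8 i; omega
        · rcases lt_trichotomy i k with h | h | h
          · have := h8 i h; omega
          · subst h; omega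
          · have := h6 k h; omega
  · intro hW
    have key : ∀ y : ℕ →₀ ℤ, sigmaD n y = sigmaD n x →
        ¬ (l1D y < l1D x ∨ (Even n ∧ l1D y = l1D x ∧
          ∃ i, (∀ j < i, |y j| = |x j|) ∧ |y i| < |x i|)) := by
      intro y hss hb
      apply hW
      have hy := list_of y (kIdx y + 1) (fun i hi => (kIdx_le y _).1 le_rfl i (by omega))
      set Y := (List.range (kIdx y + 1)).map y with hY
      have hly := l1_list y Y hy
      have hsy := sigma_list n y Y hy
      apply list_to_W n hn xs hs Y 0 0 .eq (by simp) (by rw [← hsy, ← hsx, hss]; simp)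
      rw [Win_iff]
      rcases hb with hb | ⟨h1, h2, h3⟩
      · left; omega
      · right
        refine ⟨h1, by omega, Or.inr ⟨rfl, ?_⟩⟩
        simpa only [← hx, ← hy] using h3
    refine ⟨fun y hss => ?_, fun he y hss hlen => ?_⟩
    · have := key y hss
      have := eta_ge u xs.length y
      by_contra hlt
      apply key y hss
      left; omega
    · have h1 := key y hss
      have h2 := eta_ge u xs.length y
      by_contra hlex
      apply h1
      by_cases h3 : l1D y < l1D x
      · exact Or.inl h3
      right
      refine ⟨he, by omega, ?_⟩
      unfold absLexLE at hlex
      push Not at hlex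
      obtain ⟨h4, h5⟩ := hlex
      classical
      have hfs := Nat.find_spec h4
      refine ⟨Nat.find h4, ?_, ?_⟩
      · intro j hj
        have := Nat.find_min h4 hj
        push Not at this
        exact this.symm
      · have h6 := h5 (Nat.find h4) (fun j hj => by
          have := Nat.find_min h4 hj
          push Not at this
          exact this)
        exact lt_of_le_of_ne h6 (Ne.symm hfs)

/-! Words -/

def hw (xs : List ℤ) : List Letter := (xs.map fun a => aWord a ++ [(1, true)]).flatten

lemma eta_word (u w : ℕ) (x : ℕ →₀ ℤ) (h : kIdx x < w) :
    eta1Word u w x = List.replicate u (1, false) ++ hw ((List.range w).map x) := by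
  have hz : ∀ i, kIdx x < i → x i = 0 := (kIdx_le x _).1 le_rfl
  have ht : ∀ k, aWord (x 0) ++
      (((List.range k).map fun j => tWord 1 ++ aWord (x (j + 1))).flatten) ++ [(1, true)]
      = hw ((List.range (k + 1)).map x) := by
    intro k
    induction k with
    | zero => simp [hw]
    | succ k ih =>
      rw [List.range_succ (n := k + 1), List.map_append, hw, List.map_append, List.flatten_append,
        ← hw, ← ih]
      rw [List.range_succ, List.map_append, List.flatten_append]
      simp [tWord]
  have ht2 : ∀ m, hw ((List.range (kIdx x + 1 + m)).map x)
      = hw ((List.range (kIdx x + 1)).map x) ++ List.replicate m (1, true) := by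
    intro m
    induction m with
    | zero => simp
    | succ m ih =>
      rw [← add_assoc, List.range_succ, List.map_append, hw, List.map_append,
        List.flatten_append, ← hw, ih, List.replicate_succ']
      simp [hz (kIdx x + 1 + m) (by omega), aWord]
  obtain ⟨m, rfl⟩ : ∃ m, w = kIdx x + 1 + m := ⟨w - (kIdx x + 1), by omega⟩
  rw [ht2, ← ht]
  unfold eta1Word
  have e1 : tWord (-(u : ℤ)) = List.replicate u (1, false) := by
    simp [tWord]
  have e2 : tWord (((kIdx x + 1 + m : ℕ) : ℤ) - kIdx x) = (1, true) :: List.replicate m (1, true) := by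
    have : ((kIdx x + 1 + m : ℕ) : ℤ) - kIdx x = ((m + 1 : ℕ) : ℤ) := by push_cast; ring
    rw [this, tWord, ← List.replicate_succ, Int.natAbs_natCast]
    congr 1
    simp
  rw [e1, e2]
  simp [List.append_assoc]

lemma On_eq (n : ℕ) (hn : 2 ≤ n) : OnLang n = {wd | ∃ (u : ℕ) (xs : List ℤ),
    (∀ a ∈ xs, |a| ≤ ((n / 2 : ℕ) : ℤ)) ∧ xs ∈ G n ∧
    wd = List.replicate u (1, false) ++ hw xs} := by
  ext wd
  constructor
  · rintro ⟨u, w, x, hx0, ⟨-, hb1, hb2, -⟩, hmin, hk, rfl⟩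
    have hz : ∀ i, kIdx x < i → x i = 0 := (kIdx_le x _).1 le_rfl
    have hl := list_of x w (fun i hi => hz i (by omega))
    have hbd : ∀ a ∈ (List.range w).map x, |a| ≤ ((n / 2 : ℕ) : ℤ) := by
      intro a ha
      obtain ⟨i, hi, rfl⟩ := List.mem_map.1 ha
      rcases lt_trichotomy i (kIdx x) with h | h | h
      · exact hb1 i h
      · subst h; exact hb2 (lt_of_lt_of_le hk (le_max_right _ _))
      · rw [hz i h, abs_zero]; exact Int.natCast_nonneg _
    have hmi := minimal_iff n hn u _ x hl hbd
    rw [List.length_map, List.length_range] at hmi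
    refine ⟨u, (List.range w).map x, hbd, ⟨?_, hmi.1 hmin⟩, eta_word u w x hk⟩
    obtain ⟨i, hi⟩ := Finsupp.ne_iff.1 hx0
    refine ⟨x i, List.mem_map.2 ⟨i, ?_, rfl⟩, by simpa using hi⟩
    by_contra h
    simp at h
    exact hi (by simpa using hz i (by omega))
  · rintro ⟨u, xs, hbd, ⟨⟨a, ha, ha0⟩, hW⟩, rfl⟩
    obtain ⟨x, hx⟩ : ∃ y : ℕ →₀ ℤ, ∀ i, y i = xs.getD i 0 := ⟨xs.toFinsupp, fun i => by simp⟩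
    have hbx : ∀ i, |x i| ≤ ((n / 2 : ℕ) : ℤ) := by
      intro i
      rw [hx]
      by_cases hi : i < xs.length
      · rw [List.getD_eq_getElem _ _ hi]; exact hbd _ (List.getElem_mem hi)
      · rw [List.getD_eq_default _ _ (not_lt.1 hi), abs_zero]; exact Int.natCast_nonneg _
    have hlen : 0 < xs.length := List.length_pos_of_mem ha
    have hk : kIdx x < xs.length := by
      have : kIdx x ≤ xs.length - 1 := by
        rw [kIdx_le]
        intro i hi
        rw [hx]; simp [show xs.length ≤ i by omega]
      omega
    have hxs : (List.range xs.length).map x = xs := by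
      apply List.ext_getElem
      · simp
      · intro i h1 h2
        simp [hx, h2]
    refine ⟨u, xs.length, x, ?_, ⟨rfl, fun i _ => hbx i, fun _ => hbx _, fun h => ?_⟩,
      (minimal_iff n hn u xs x hx hbd).2 hW, hk, ?_⟩
    · rintro rfl
      obtain ⟨i, hi, rfl⟩ := List.getElem_of_mem ha
      apply ha0
      have := hx i
      rw [List.getD_eq_getElem _ _ hi] at this
      simpa using this.symm
    · exact absurd (lt_of_lt_of_le hk (le_max_right u _)) (not_lt.2 h)
    · rw [eta_word _ _ _ hk, hxs]

/-! The letter automaton -/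

section aut
variable {S : Type} (B : ℕ) (M : DFA ℤ S)

abbrev St (S : Type) (B : ℕ) : Type := Option (Bool × Finset.Icc (-(B : ℤ)) B × S)

noncomputable def mk (b : Bool) (j : ℤ) (s : S) : St S B :=
  if h : j ∈ Finset.Icc (-(B : ℤ)) B then some (b, ⟨j, h⟩, s) else none

noncomputable def stp : St S B → Letter → St S B
  | none, _ => none
  | some (b, j, s), (0, true) => if 0 ≤ j.1 then mk B false (j.1 + 1) s else none
  | some (b, j, s), (0, false) => if j.1 ≤ 0 then mk B false (j.1 - 1) s else none
  | some (_, j, s), (1, true) => mk B false 0 (M.step s j.1)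
  | some (b, j, s), (1, false) => if b then some (b, j, s) else none

noncomputable def aut : DFA Letter (St S B) where
  step := stp B M
  start := mk B true 0 M.start
  accept := {q | ∃ b s, q = mk B b 0 s ∧ s ∈ M.accept}

lemma mk_some {j : ℤ} (hj : |j| ≤ B) (b : Bool) (s : S) :
    mk B b j s = some (b, ⟨j, by simpa [abs_le] using hj⟩, s) := by
  unfold mk
  rw [dif_pos]

noncomputable def ef (q : St S B) (wd : List Letter) : St S B := wd.foldl (stp B M) q

lemma ef_append (q : St S B) (v w : List Letter) :
    ef B M q (v ++ w) = ef B M (ef B M q v) w := by simp [ef]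

lemma ef_a_pos (b : Bool) (s : S) (k : ℕ) (hk : k ≤ B) :
    ef B M (mk B b 0 s) (List.replicate k (0, true)) = mk B (b && decide (k = 0)) k s := by
  induction k with
  | zero => simp [ef]
  | succ k ih =>
    rw [List.replicate_succ', ef_append, ih (by omega), mk_some B (by simp; omega)]
    simp [ef, stp]

lemma ef_a_neg (b : Bool) (s : S) (k : ℕ) (hk : k ≤ B) :
    ef B M (mk B b 0 s) (List.replicate k (0, false)) = mk B (b && decide (k = 0)) (-k) s := by
  induction k with
  | zero => simp [ef]
  | succ k ih =>
    rw [List.replicate_succ', ef_append, ih (by omega), mk_some B (by simp; omega)]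
    simp [ef, stp]
    congr 1
    ring

lemma ef_digit (b : Bool) (s : S) (a : ℤ) (ha : |a| ≤ B) :
    ef B M (mk B b 0 s) (aWord a ++ [(1, true)]) = mk B false 0 (M.step s a) := by
  have h1 : ∃ b', ef B M (mk B b 0 s) (aWord a) = mk B b' a s := by
    unfold aWord
    rw [abs_le] at ha
    rcases lt_or_ge 0 a with h | h
    · rw [decide_eq_true h, ef_a_pos _ _ _ _ _ (by omega)]
      exact ⟨_, by rw [Int.natAbs_of_nonneg h.le]⟩
    · rw [decide_eq_false (by omega), ef_a_neg _ _ _ _ _ (by omega)]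
      exact ⟨b && decide (a.natAbs = 0), by rw [Int.ofNat_natAbs_of_nonpos h, neg_neg]⟩
  obtain ⟨b', h1⟩ := h1
  rw [ef_append, h1, mk_some B ha]
  simp [ef, stp]

lemma ef_hw (xs : List ℤ) (hx : ∀ a ∈ xs, |a| ≤ B) (b : Bool) (s : S) :
    ∃ b', ef B M (mk B b 0 s) (hw xs) = mk B b' 0 (M.evalFrom s xs) := by
  induction xs generalizing b s with
  | nil => exact ⟨b, by simp [hw, ef]⟩
  | cons a xs ih =>
    have : hw (a :: xs) = (aWord a ++ [(1, true)]) ++ hw xs := by simp [hw]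
    rw [this, ef_append, ef_digit _ _ _ _ _ (hx a (by simp))]
    obtain ⟨b', h⟩ := ih (fun c hc => hx c (by simp [hc])) false (M.step s a)
    exact ⟨b', by rw [h]; simp⟩

lemma ef_u (u : ℕ) (s : S) :
    ef B M (mk B true 0 s) (List.replicate u (1, false)) = mk B true 0 s := by
  induction u with
  | zero => simp [ef]
  | succ u ih =>
    rw [List.replicate_succ', ef_append, ih, mk_some B (by simp)]
    simp [ef, stp]

lemma ef_inv (wd : List Letter) (b : Bool) (j : Finset.Icc (-(B : ℤ)) B) (s : S)
    (h : ef B M (mk B true 0 M.start) wd = some (b, j, s)) :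
    ∃ (u : ℕ) (xs : List ℤ), (∀ a ∈ xs, |a| ≤ B) ∧
      wd = List.replicate u (1, false) ++ hw xs ++ aWord j.1 ∧ s = M.eval xs ∧
      (b = true → xs = [] ∧ j.1 = 0) := by
  induction wd using List.reverseRecOn generalizing b j s with
  | nil =>
    rw [mk_some B (by simp)] at h
    simp only [ef, List.foldl_nil, Option.some.injEq, Prod.mk.injEq] at h
    obtain ⟨rfl, rfl, rfl⟩ := h
    exact ⟨0, [], by simp, by simp [hw, aWord], by simp, by simp⟩
  | append_singleton wd l ih =>
    rw [ef_append] at h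
    rcases hq : ef B M (mk B true 0 M.start) wd with _ | ⟨b0, j0, s0⟩
    · rw [hq] at h; simp [ef, stp] at h
    obtain ⟨u, xs, hxs, hwd, hs0, hb0⟩ := ih b0 j0 s0 hq
    rw [hq] at h
    have hj0 : |j0.1| ≤ B := by
      have := j0.2
      rw [Finset.mem_Icc] at this
      exact abs_le.2 this
    obtain ⟨l1, l2⟩ := l
    fin_cases l1 <;> cases l2 <;> simp only [ef, List.foldl_cons, List.foldl_nil] at h
    · change (if j0.1 ≤ 0 then mk B false (j0.1 - 1) s0 else none) = _ at h
      unfold mk at h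
      split_ifs at h with h1 h2
      simp only [Option.some.injEq, Prod.mk.injEq] at h
      obtain ⟨rfl, rfl, rfl⟩ := h
      refine ⟨u, xs, hxs, ?_, hs0, by simp⟩
      rw [hwd, List.append_assoc _ (aWord _)]
      congr 1
      simp only [aWord]
      rw [decide_eq_false (by omega), decide_eq_false (by omega),
        show (j0.1 - 1).natAbs = j0.1.natAbs + 1 by omega, List.replicate_succ']
      rfl
    · change (if 0 ≤ j0.1 then mk B false (j0.1 + 1) s0 else none) = _ at h
      unfold mk at h
      split_ifs at h with h1 h2
      simp only [Option.some.injEq, Prod.mk.injEq] at h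
      obtain ⟨rfl, rfl, rfl⟩ := h
      refine ⟨u, xs, hxs, ?_, hs0, by simp⟩
      rw [hwd, List.append_assoc _ (aWord _)]
      congr 1
      simp only [aWord]
      rw [decide_eq_true (show 0 < j0.1 + 1 by omega),
        show (j0.1 + 1).natAbs = j0.1.natAbs + 1 by omega, List.replicate_succ']
      rcases h1.eq_or_lt with h3 | h3
      · rw [← h3]; rfl
      · rw [decide_eq_true h3]; rfl
    · change (if b0 = true then some (b0, j0, s0) else none) = _ at h
      split_ifs at h with h1
      simp only [Option.some.injEq, Prod.mk.injEq] at h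
      obtain ⟨rfl, rfl, rfl⟩ := h
      obtain ⟨rfl, h2⟩ := hb0 h1
      refine ⟨u + 1, [], hxs, ?_, hs0, fun _ => ⟨rfl, h2⟩⟩
      rw [hwd, h2, List.replicate_succ']
      simp [hw, aWord]
    · change mk B false 0 (M.step s0 j0.1) = _ at h
      rw [mk_some B (by simp)] at h
      simp only [Option.some.injEq, Prod.mk.injEq] at h
      obtain ⟨rfl, rfl, rfl⟩ := h
      refine ⟨u, xs ++ [j0.1], ?_, ?_, ?_, by simp⟩
      · intro a ha
        rcases List.mem_append.1 ha with ha | ha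
        · exact hxs a ha
        · rw [List.mem_singleton.1 ha]; exact hj0
      · rw [hwd]; simp [hw, aWord]
      · rw [hs0]; simp

lemma aut_accepts : (aut B M).accepts = {wd | ∃ (u : ℕ) (xs : List ℤ),
    (∀ a ∈ xs, |a| ≤ (B : ℤ)) ∧ xs ∈ M.accepts ∧
    wd = List.replicate u (1, false) ++ hw xs} := by
  ext wd
  have e : wd ∈ (aut B M).accepts ↔
    ∃ b s, ef B M (mk B true 0 M.start) wd = mk B b 0 s ∧ s ∈ M.accept := Iff.rfl
  rw [e]
  constructor
  · rintro ⟨b, s, h, hs⟩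
    rw [mk_some B (j := 0) (by simp) b s] at h
    obtain ⟨u, xs, h1, h2, h3, -⟩ := ef_inv B M wd _ _ _ h
    refine ⟨u, xs, h1, ?_, by simpa [aWord] using h2⟩
    rw [DFA.mem_accepts, ← h3]; exact hs
  · rintro ⟨u, xs, h1, h2, rfl⟩
    rw [ef_append, ef_u]
    obtain ⟨b', h⟩ := ef_hw B M xs h1 true M.start
    exact ⟨b', _, h, h2⟩

end aut

end OnAux

/-- For every `n ≥ 2`, the language `O_n` of minimal strict shape 1 geodesics of
`BS(1,n)` is regular over the four-letter alphabet `{a, a⁻¹, t, t⁻¹}`: it is accepted by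
a deterministic finite automaton with finitely many states. -/
theorem On_regular (n : ℕ) (hn : 2 ≤ n) :
    ∃ (S : Type) (_ : Fintype S) (M : DFA Letter S), M.accepts = OnLang n := by
  obtain ⟨S, hS, M, hM⟩ := OnAux.G_regular n
  refine ⟨OnAux.St S (n / 2), inferInstance, OnAux.aut (n / 2) M, ?_⟩
  rw [OnAux.On_eq n hn, OnAux.aut_accepts, hM]
end

section
/- For each integer m ≥ 1, let r_m be the unique root in the open interval (0,1) of the polynomial 1 − x − Σ_{i=1}^{m} 2x^{i+1}, and let s_m be the unique root in (0,1) of the polynomial 1 − 2x − x² + 2x^{m+1} − 2x^{m+2} + 2x^{2m+2}. Then r_m → √2 − 1 and s_m → √2 − 1 as m → ∞; equivalently, the growth rates 1/r_m and 1/s_m of the groups BS(1,n) both converge to 1 + √2 as n → ∞. -/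
open Filter Topology

lemma aux_tendsto (x : ℕ → ℝ) (h : ∀ m : ℕ, 2 ≤ m → 0 < x m ∧ x m ≤ 1 / 2 ∧
    |1 - 2 * x m - x m ^ 2| ≤ 4 * x m ^ m) :
    Tendsto x atTop (𝓝 (Real.sqrt 2 - 1)) ∧
    Tendsto (fun m => 1 / x m) atTop (𝓝 (1 + Real.sqrt 2)) := by
  have h2 : Real.sqrt 2 ^ 2 = 2 := Real.sq_sqrt (by norm_num)
  have h1 : 1 < Real.sqrt 2 := Real.lt_sqrt_of_sq_lt (by norm_num)
  have key : Tendsto x atTop (𝓝 (Real.sqrt 2 - 1)) := by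
    rw [tendsto_iff_dist_tendsto_zero]
    have hz : Tendsto (fun m : ℕ => 4 * (1 / 2 : ℝ) ^ m) atTop (𝓝 0) := by
      simpa using (tendsto_pow_atTop_nhds_zero_of_lt_one (r := (1 / 2 : ℝ))
        (by norm_num) (by norm_num)).const_mul 4
    refine squeeze_zero' (Eventually.of_forall fun _ => dist_nonneg) ?_ hz
    filter_upwards [eventually_ge_atTop 2] with m hm
    obtain ⟨h0, hh, hb⟩ := h m hm
    have hp : x m ^ m ≤ (1 / 2 : ℝ) ^ m := pow_le_pow_left₀ h0.le hh m
    have e : 1 - 2 * x m - x m ^ 2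
        = -((x m - (Real.sqrt 2 - 1)) * (x m + 1 + Real.sqrt 2)) := by
      linear_combination (-1 : ℝ) * h2
    rw [e, abs_neg, abs_mul, abs_of_pos (by linarith : 0 < x m + 1 + Real.sqrt 2)] at hb
    rw [Real.dist_eq]
    nlinarith [abs_nonneg (x m - (Real.sqrt 2 - 1))]
  refine ⟨key, ?_⟩
  have e : 1 + Real.sqrt 2 = 1 / (Real.sqrt 2 - 1) := by
    rw [eq_div_iff (by linarith)]
    linear_combination h2
  rw [e]
  exact tendsto_const_nhds.div key (by linarith)

lemma aux_r (x : ℝ) (h0 : 0 < x) (m : ℕ) (hm : 1 ≤ m)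
    (h : 1 - x - ∑ i ∈ Finset.Icc 1 m, 2 * x ^ (i + 1) = 0) :
    x ≤ 1 / 2 ∧ |1 - 2 * x - x ^ 2| ≤ 4 * x ^ m := by
  have hle : 2 * x ^ (1 + 1) ≤ ∑ i ∈ Finset.Icc 1 m, 2 * x ^ (i + 1) :=
    Finset.single_le_sum (f := fun i => 2 * x ^ (i + 1)) (fun i _ => by positivity)
      (Finset.mem_Icc.2 ⟨le_refl 1, hm⟩)
  have hh : 2 * x ^ 2 ≤ 1 - x := by
    norm_num at hle
    linarith
  have hx : x ≤ 1 / 2 := by nlinarith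
  refine ⟨hx, ?_⟩
  have hg : ∀ k : ℕ, (1 - x) * ∑ i ∈ Finset.Icc 1 k, 2 * x ^ (i + 1)
      = 2 * x ^ 2 - 2 * x ^ (k + 2) := by
    intro k
    induction k with
    | zero => simp
    | succ k ih =>
      rw [Finset.sum_Icc_succ_top (by omega), mul_add, ih]
      ring
  have e : 1 - 2 * x - x ^ 2 = -(2 * x ^ m * x ^ 2) := by
    linear_combination (1 - x) * h + hg m
  have hp : 0 < x ^ m := by positivity
  rw [e, abs_neg, abs_of_pos (by positivity)]
  have hq : x ^ 2 ≤ 1 := by nlinarith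
  nlinarith [mul_le_mul_of_nonneg_left hq hp.le]

lemma aux_s (x : ℝ) (h0 : 0 < x) (h1 : x < 1) (m : ℕ) (hm : 2 ≤ m)
    (h : 1 - 2 * x - x ^ 2 + 2 * x ^ (m + 1) - 2 * x ^ (m + 2)
        + 2 * x ^ (2 * m + 2) = 0) :
    x ≤ 1 / 2 ∧ |1 - 2 * x - x ^ 2| ≤ 4 * x ^ m := by
  obtain ⟨k, rfl⟩ : ∃ k, m = k + 2 := ⟨m - 2, by omega⟩
  set S := ∑ i ∈ Finset.range (2 * (k + 2)), x ^ i with hS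
  have hg : S * (1 - x) = 1 - x ^ (2 * (k + 2)) := geom_sum_mul_neg x _
  have hsub : ∑ i ∈ ({0, k + 1} : Finset ℕ), x ^ i ≤ S := by
    refine Finset.sum_le_sum_of_subset_of_nonneg ?_ (fun i _ _ => by positivity)
    intro i hi
    simp only [Finset.mem_insert, Finset.mem_singleton] at hi
    rw [Finset.mem_range]
    omega
  rw [Finset.sum_pair (by omega), pow_zero] at hsub
  have e : (1 - x) * (1 - x - 2 * x ^ 2 * S + 2 * x ^ (k + 3)) = 0 := by
    linear_combination h - 2 * x ^ 2 * hg
  have e2 := (mul_eq_zero.1 e).resolve_left (by linarith)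
  have e3 : x ^ 2 * (1 + x ^ (k + 1)) ≤ x ^ 2 * S :=
    mul_le_mul_of_nonneg_left hsub (by positivity)
  have e4 : x ^ (k + 3) = x ^ 2 * x ^ (k + 1) := by ring
  have hx : x ≤ 1 / 2 := by nlinarith
  refine ⟨hx, ?_⟩
  have hp : 0 < x ^ (k + 2) := by positivity
  have hp1 : x ^ (k + 2) ≤ 1 := pow_le_one₀ h0.le h1.le
  have e5 : 1 - 2 * x - x ^ 2
      = -(x ^ (k + 2) * (2 * (x * (1 - x)) + 2 * (x ^ (k + 2) * x ^ 2))) := by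
    linear_combination h
  have hq : 0 < x * (1 - x) := mul_pos h0 (by linarith)
  rw [e5, abs_neg, abs_of_pos (by positivity), mul_comm 4]
  apply mul_le_mul_of_nonneg_left _ hp.le
  have : x ^ (k + 2) * x ^ 2 ≤ 1 := mul_le_one₀ hp1 (by positivity) (by nlinarith)
  nlinarith

/-- Let `r m` be the unique root in `(0,1)` of `1 - x - ∑_{i=1}^m 2x^{i+1}` and `s m` the
unique root in `(0,1)` of `1 - 2x - x² + 2x^{m+1} - 2x^{m+2} + 2x^{2m+2}` (for `m ≥ 1`).
Then `r m → √2 - 1` and `s m → √2 - 1`; equivalently, the growth rates `1/r m` and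
`1/s m` of the groups `BS(1,n)` both converge to `1 + √2`. -/
theorem roots_tendsto_sqrt_two_sub_one (r s : ℕ → ℝ)
    (hr : ∀ m : ℕ, 1 ≤ m → (0 < r m ∧ r m < 1) ∧
      1 - r m - ∑ i ∈ Finset.Icc 1 m, 2 * r m ^ (i + 1) = 0)
    (hs : ∀ m : ℕ, 1 ≤ m → (0 < s m ∧ s m < 1) ∧
      1 - 2 * s m - s m ^ 2 + 2 * s m ^ (m + 1) - 2 * s m ^ (m + 2)
        + 2 * s m ^ (2 * m + 2) = 0) :
    Tendsto r atTop (𝓝 (Real.sqrt 2 - 1)) ∧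
    Tendsto s atTop (𝓝 (Real.sqrt 2 - 1)) ∧
    Tendsto (fun m => 1 / r m) atTop (𝓝 (1 + Real.sqrt 2)) ∧
    Tendsto (fun m => 1 / s m) atTop (𝓝 (1 + Real.sqrt 2)) := by
  obtain ⟨a, b⟩ := aux_tendsto r fun m hm => ⟨(hr m (by omega)).1.1,
    aux_r _ (hr m (by omega)).1.1 m (by omega) (hr m (by omega)).2⟩
  obtain ⟨c, d⟩ := aux_tendsto s fun m hm => ⟨(hs m (by omega)).1.1,
    aux_s _ (hs m (by omega)).1.1 (hs m (by omega)).1.2 m hm (hs m (by omega)).2⟩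
  exact ⟨a, c, b, d⟩
end

section
/- For every integer α ≥ 1, the following identity holds in the polynomial ring ℤ[x]: (1 − x) · det(I − M(x)) = 1 − 2x − x² + 2x^{α+1} − 2x^{α+2} + 2x^{2α+2}, where M(x) is the 3×3 matrix over ℤ[x] with first row (x + 2Σ_{i=1}^{α−1} x^{i+1}, x^{α+1}, x^{α+1}), second row (Σ_{i=0}^{α−1} x^{i+1}, 0, 0), and third row (Σ_{i=0}^{α−1} x^{i+1}, 0, 0), and I is the 3×3 identity matrix. -/
open Polynomial

/-- The transition-series matrix for the strict shape 1 automaton of `BS(1,n)`, `n` even,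
with `α = n/2`. -/
noncomputable def transMatrix (α : ℕ) : Matrix (Fin 3) (Fin 3) (Polynomial ℤ) :=
  Matrix.of
    ![![X + ∑ i ∈ Finset.Icc 1 (α - 1), 2 * X ^ (i + 1), X ^ (α + 1), X ^ (α + 1)],
      ![∑ i ∈ Finset.range α, X ^ (i + 1), 0, 0],
      ![∑ i ∈ Finset.range α, X ^ (i + 1), 0, 0]]

/-- The identity `(1 - x)·det(I - M(x)) = 1 - 2x - x² + 2x^{α+1} - 2x^{α+2} + 2x^{2α+2}`
in `ℤ[x]`, for every `α ≥ 1`. -/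
theorem det_transMatrix (α : ℕ) (hα : 1 ≤ α) :
    (1 - X) * ((1 : Matrix (Fin 3) (Fin 3) (Polynomial ℤ)) - transMatrix α).det =
      1 - 2 * X - X ^ 2 + 2 * X ^ (α + 1) - 2 * X ^ (α + 2) + 2 * X ^ (2 * α + 2) := by
  obtain ⟨k, rfl⟩ : ∃ k, α = k + 1 := ⟨α - 1, by omega⟩
  have h1 : ∀ n : ℕ, (1 - X) * (∑ i ∈ Finset.range n, (X : Polynomial ℤ) ^ (i + 1)) =
      X - X ^ (n + 1) := by
    intro n
    induction n with
    | zero => simp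
    | succ n ih => rw [Finset.sum_range_succ, mul_add, ih]; ring
  have h2 : ∀ n : ℕ, (1 - X) * (∑ i ∈ Finset.Icc 1 n, 2 * (X : Polynomial ℤ) ^ (i + 1)) =
      2 * X ^ 2 - 2 * X ^ (n + 2) := by
    intro n
    induction n with
    | zero => simp
    | succ n ih => rw [Finset.sum_Icc_succ_top (by omega), mul_add, ih]; ring
  have e1 := h1 (k + 1)
  have e2 := h2 k
  rw [Matrix.det_fin_three]
  simp only [transMatrix, Nat.add_sub_cancel]
  generalize (∑ i ∈ Finset.range (k + 1), (X : Polynomial ℤ) ^ (i + 1)) = c at *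
  generalize (∑ i ∈ Finset.Icc 1 k, 2 * (X : Polynomial ℤ) ^ (i + 1)) = a at *
  simp
  linear_combination (-2 * X ^ (k + 2)) * e1 - e2
end
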